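/- arXiv:2309.14699 — 3 statements merged into one kernel-verified Lean document; each statement's English description precedes it below -/
import Mathlib

section
/- Let 𝔽 be a field of characteristic 0, let n ≥ 3, and let 𝔮 = (q_{ij}) be a multiplicatively antisymmetric n×n matrix over 𝔽 with q_{ij} ≠ 1 for all 1 ≤ i < j ≤ n. Then every 𝔽-algebra automorphism of the quantum affine space 𝒪_𝔮 is scalar if and only if both of the following hold: (a) Λ_i is empty for every i (i.e. E = 0), and (b) there is no non-identity permutation σ of {1,…,n} satisfying q_{ij} = q_{σ(i)σ(j)} for all 1 ≤ i < j ≤ n. -/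
/-- The defining relations of the multiparameter quantum affine space:
`X i * X j = q i j • (X j * X i)` for `i < j`. -/
inductive QuantumRel (F : Type*) [Field F] (n : ℕ) (q : Fin n → Fin n → F) :
    FreeAlgebra F (Fin n) → FreeAlgebra F (Fin n) → Prop
  | rel (i j : Fin n) (h : i < j) :
      QuantumRel F n q (FreeAlgebra.ι F i * FreeAlgebra.ι F j)
        (q i j • (FreeAlgebra.ι F j * FreeAlgebra.ι F i))

/-- The multiparameter quantum affine space `𝒪_𝔮`. -/
abbrev QuantumAffineSpace (F : Type*) [Field F] (n : ℕ) (q : Fin n → Fin n → F) :=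
  RingQuot (QuantumRel F n q)

/-- The canonical generators `X i` of the quantum affine space. -/
noncomputable def QX (F : Type*) [Field F] (n : ℕ) (q : Fin n → Fin n → F) (i : Fin n) :
    QuantumAffineSpace F n q :=
  RingQuot.mkAlgHom F (QuantumRel F n q) (FreeAlgebra.ι F i)

/-- A multiplicatively antisymmetric matrix: nonzero entries, `q i i = 1`, `q j i = (q i j)⁻¹`. -/
def MultAntisym (F : Type*) [Field F] {n : ℕ} (q : Fin n → Fin n → F) : Prop :=
  (∀ i j, q i j ≠ 0) ∧ (∀ i, q i i = 1) ∧ (∀ i j, q j i = (q i j)⁻¹)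

/-- An `F`-algebra automorphism of the quantum affine space is scalar if it sends each
generator `X i` to a nonzero scalar multiple of itself. -/
def IsScalarAut (F : Type*) [Field F] (n : ℕ) (q : Fin n → Fin n → F)
    (σ : QuantumAffineSpace F n q ≃ₐ[F] QuantumAffineSpace F n q) : Prop :=
  ∃ a : Fin n → F, (∀ i, a i ≠ 0) ∧ ∀ i, σ (QX F n q i) = a i • QX F n q i

/-- `E = 0`: each set `Λ_i` is empty. -/
def LambdaEmpty (F : Type*) [Field F] {n : ℕ} (q : Fin n → Fin n → F) : Prop :=
  ∀ i : Fin n, ∀ ν : Fin n → ℕ,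
    ¬ (ν i = 0 ∧ ∀ j, j ≠ i → (∏ k, q k j ^ ν k) = q i j)

/-- The `λ`-group: the subgroup of `Fˣ` generated by the multiparameters `q i j`, `i < j`. -/
def lambdaGroup (F : Type*) [Field F] {n : ℕ} (q : Fin n → Fin n → F) : Subgroup Fˣ :=
  Subgroup.closure {u : Fˣ | ∃ i j : Fin n, i < j ∧ (u : F) = q i j}

section LeadingExponent

variable {F A ι Γ : Type*} [Field F] [Ring A] [Algebra F A]

/-- `ν` is the largest exponent, for the order pulled back along `w`, that occurs in the expansion
of `a` in the basis `b`. -/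
structure IsLeadingExponent [LE Γ] (b : Module.Basis ι F A) (w : ι → Γ) (a : A) (ν : ι) :
    Prop where
  repr_ne_zero : b.repr a ν ≠ 0
  le : ∀ μ, b.repr a μ ≠ 0 → w μ ≤ w ν

variable [LinearOrder Γ] {b : Module.Basis ι F A} {w : ι → Γ}

theorem exists_isLeadingExponent (b : Module.Basis ι F A) (w : ι → Γ) {a : A} (ha : a ≠ 0) :
    ∃ ν, IsLeadingExponent b w a ν := by
  obtain ⟨ν, hν, hmax⟩ := (b.repr a).support.exists_max_image w (by simpa using ha)
  exact ⟨ν, by simpa using hν, fun μ hμ => hmax μ (by simpa using hμ)⟩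

theorem IsLeadingExponent.unique (hw : Function.Injective w) {a : A} {ν μ : ι}
    (hν : IsLeadingExponent b w a ν) (hμ : IsLeadingExponent b w a μ) : ν = μ :=
  hw (le_antisymm (hμ.le ν hν.repr_ne_zero) (hν.le μ hμ.repr_ne_zero))

theorem isLeadingExponent_basis (ν : ι) : IsLeadingExponent b w (b ν) ν where
  repr_ne_zero := by simp
  le μ hμ := by
    classical
    rw [b.repr_self, Finsupp.single_apply] at hμ
    simp_all

theorem IsLeadingExponent.mul [AddCommMonoid ι] [AddCommMonoid Γ] [IsOrderedCancelAddMonoid Γ]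
    (hw : Function.Injective w) (hadd : ∀ ν μ, w (ν + μ) = w ν + w μ)
    (hb : ∀ ν μ, ∃ c : F, c ≠ 0 ∧ b ν * b μ = c • b (ν + μ)) {x y : A} {ν μ : ι}
    (hx : IsLeadingExponent b w x ν) (hy : IsLeadingExponent b w y μ) :
    IsLeadingExponent b w (x * y) (ν + μ) := by
  classical
  choose c hc hbc using hb
  have key : ∀ ρ, b.repr (x * y) ρ = ∑ α ∈ (b.repr x).support, ∑ β ∈ (b.repr y).support,
      if α + β = ρ then b.repr x α * b.repr y β * c α β else 0 := by
    intro ρ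
    conv_lhs => rw [← b.linearCombination_repr x, ← b.linearCombination_repr y]
    simp only [Finsupp.linearCombination_apply, Finsupp.sum, Finset.sum_mul, Finset.mul_sum,
      smul_mul_smul_comm, hbc, map_sum, map_smul, b.repr_self, Finsupp.finsetSum_apply,
      Finsupp.smul_apply, Finsupp.single_apply, smul_eq_mul]
    rw [Finset.sum_comm]
    refine Finset.sum_congr rfl fun α _ => Finset.sum_congr rfl fun β _ => ?_
    split_ifs <;> ring
  refine ⟨?_, fun ρ hρ => ?_⟩
  · have hlt : ∀ α β, b.repr x α ≠ 0 → b.repr y β ≠ 0 → α + β = ν + μ → α = ν ∧ β = μ := by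
      intro α β hα hβ h
      have h1 := hx.le α hα
      have h2 := hy.le β hβ
      have h3 : w α + w β = w ν + w μ := by rw [← hadd, ← hadd, h]
      obtain ⟨h4, h5⟩ := (add_eq_add_iff_eq_and_eq h1 h2).1 h3
      exact ⟨hw h4, hw h5⟩
    rw [key, Finset.sum_eq_single ν, Finset.sum_eq_single μ, if_pos rfl]
    · exact mul_ne_zero (mul_ne_zero hx.repr_ne_zero hy.repr_ne_zero) (hc _ _)
    · intro β hβ hne
      exact if_neg fun h => hne (hlt ν β hx.repr_ne_zero (by simpa using hβ) h).2
    · intro h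
      exact absurd (by simpa using h) hy.repr_ne_zero
    · intro α hα hne
      refine Finset.sum_eq_zero fun β hβ => if_neg fun h => hne ?_
      exact (hlt α β (by simpa using hα) (by simpa using hβ) h).1
    · intro h
      exact absurd (by simpa using h) hx.repr_ne_zero
  · rw [key] at hρ
    obtain ⟨α, hα, h⟩ := Finset.exists_ne_zero_of_sum_ne_zero hρ
    obtain ⟨β, hβ, h⟩ := Finset.exists_ne_zero_of_sum_ne_zero h
    obtain rfl : α + β = ρ := by
      by_contra hne
      exact h (if_neg hne)
    rw [hadd, hadd]
    exact add_le_add (hx.le α (by simpa using hα)) (hy.le β (by simpa using hβ))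

end LeadingExponent

namespace QuantumAffineSpace

variable {F : Type*} [Field F] {n : ℕ} {q : Fin n → Fin n → F}

theorem algHom_ext {B : Type*} [Ring B] [Algebra F B] {f g : QuantumAffineSpace F n q →ₐ[F] B}
    (h : ∀ i, f (QX F n q i) = g (QX F n q i)) : f = g :=
  RingQuot.ringQuot_ext' _ _ _ (FreeAlgebra.hom_ext (funext h))

/-- The universal property of the quantum affine space. -/
theorem exists_algHom {B : Type*} [Ring B] [Algebra F B] (g : Fin n → B)
    (hg : ∀ i j, i < j → g i * g j = q i j • (g j * g i)) :
    ∃ f : QuantumAffineSpace F n q →ₐ[F] B, ∀ i, f (QX F n q i) = g i := by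
  refine ⟨RingQuot.liftAlgHom F ⟨FreeAlgebra.lift F g, ?_⟩, fun i => ?_⟩
  · rintro _ _ ⟨i, j, h⟩
    simpa using hg i j h
  · rw [QX, RingQuot.liftAlgHom_mkAlgHom_apply, FreeAlgebra.lift_ι_apply]

theorem adjoin_range_QX : Algebra.adjoin F (Set.range (QX F n q)) = ⊤ := by
  have h : Set.range (QX F n q) =
      RingQuot.mkAlgHom F (QuantumRel F n q) '' Set.range (FreeAlgebra.ι F) := by
    rw [← Set.range_comp]
    rfl
  rw [h, ← AlgHom.map_adjoin, FreeAlgebra.adjoin_range_ι, Algebra.map_top,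
    AlgHom.range_eq_top]
  exact RingQuot.mkAlgHom_surjective F _

theorem QX_mul_QX (hq : MultAntisym F q) (i j : Fin n) :
    QX F n q i * QX F n q j = q i j • (QX F n q j * QX F n q i) := by
  have key : ∀ i j, i < j →
      QX F n q i * QX F n q j = q i j • (QX F n q j * QX F n q i) := fun i j h => by
    simpa [QX] using RingQuot.mkAlgHom_rel F (QuantumRel.rel (q := q) i j h)
  rcases lt_trichotomy i j with h | rfl | h
  · exact key i j h
  · rw [hq.2.1, one_smul]
  · rw [key j i h, smul_smul, hq.2.2 j i, inv_mul_cancel₀ (hq.1 j i), one_smul]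

/-- The product of the generators along a word. -/
noncomputable def word (q : Fin n → Fin n → F) (l : List (Fin n)) : QuantumAffineSpace F n q :=
  (l.map (QX F n q)).prod

@[simp] theorem word_nil : word q [] = 1 := rfl

@[simp] theorem word_cons (i : Fin n) (l : List (Fin n)) :
    word q (i :: l) = QX F n q i * word q l := by
  simp [word]

theorem word_append (l l' : List (Fin n)) : word q (l ++ l') = word q l * word q l' := by
  simp [word]

theorem exists_word_eq_smul_of_perm (hq : MultAntisym F q) {l l' : List (Fin n)}
    (h : l.Perm l') : ∃ c : F, c ≠ 0 ∧ word q l = c • word q l' := by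
  induction h with
  | nil => exact ⟨1, one_ne_zero, by simp⟩
  | cons i _ ih =>
    obtain ⟨c, hc, h⟩ := ih
    exact ⟨c, hc, by simp [h]⟩
  | swap i j l =>
    refine ⟨q j i, hq.1 j i, ?_⟩
    simp only [word_cons, ← mul_assoc]
    rw [QX_mul_QX hq j i, smul_mul_assoc]
  | trans _ _ ih₁ ih₂ =>
    obtain ⟨c, hc, h⟩ := ih₁
    obtain ⟨d, hd, h'⟩ := ih₂
    exact ⟨c * d, mul_ne_zero hc hd, by rw [h, h', smul_smul]⟩

/-- The exponent vector of a word. -/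
def content (l : List (Fin n)) : Fin n → ℕ := fun k => l.count k

@[simp] theorem content_nil : content ([] : List (Fin n)) = 0 := by
  ext; simp [content]

theorem content_cons (i : Fin n) (l : List (Fin n)) :
    content (i :: l) = Pi.single i 1 + content l := by
  ext k
  by_cases h : k = i
  · subst h
    simp [content, add_comm]
  · simp [content, h, List.count_cons_of_ne (Ne.symm h)]

theorem content_append (l l' : List (Fin n)) :
    content (l ++ l') = content l + content l' := by
  ext; simp [content]

theorem perm_of_content_eq {l l' : List (Fin n)} (h : content l = content l') : l.Perm l' :=
  List.perm_iff_count.2 fun k => congrFun h k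

/-- A word with prescribed exponent vector. -/
noncomputable def stdWord (ν : Fin n → ℕ) : List (Fin n) :=
  (∑ k, ν k • ({k} : Multiset (Fin n))).toList

@[simp] theorem content_stdWord (ν : Fin n → ℕ) : content (stdWord ν) = ν := by
  ext k
  simp [content, stdWord, ← Multiset.coe_count, Multiset.count_sum', Multiset.count_singleton]

/-- The monomial with exponent vector `ν`. -/
noncomputable def monomial (q : Fin n → Fin n → F) (ν : Fin n → ℕ) : QuantumAffineSpace F n q :=
  word q (stdWord ν)

theorem exists_word_eq_smul_monomial (hq : MultAntisym F q) (l : List (Fin n)) :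
    ∃ c : F, c ≠ 0 ∧ word q l = c • monomial q (content l) :=
  exists_word_eq_smul_of_perm hq (perm_of_content_eq (by simp))

theorem monomial_zero : monomial q 0 = 1 := by
  have h : stdWord (0 : Fin n → ℕ) = [] :=
    List.perm_nil.1 (perm_of_content_eq (by simp))
  simp [monomial, h]

theorem monomial_single (i : Fin n) : monomial q (Pi.single i 1) = QX F n q i := by
  have h : stdWord (Pi.single i 1) = [i] :=
    List.perm_singleton.1 (perm_of_content_eq (by simp [content_cons]))
  simp [monomial, h]

theorem exists_monomial_mul_monomial (hq : MultAntisym F q) (ν μ : Fin n → ℕ) :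
    ∃ c : F, c ≠ 0 ∧ monomial q ν * monomial q μ = c • monomial q (ν + μ) := by
  simpa [monomial, ← word_append, content_append] using
    exists_word_eq_smul_monomial hq (stdWord ν ++ stdWord μ)

/-- An element that commutes with the generators occurring in a word up to scalars commutes with
the word up to a scalar. -/
theorem mul_word {z : QuantumAffineSpace F n q} {t : Fin n → F} {l : List (Fin n)}
    (h : ∀ k ∈ l, z * QX F n q k = t k • (QX F n q k * z)) :
    z * word q l = (∏ k, t k ^ content l k) • (word q l * z) := by
  induction l with
  | nil => simp
  | cons i l ih =>
    have hprod : ∏ k, t k ^ content (i :: l) k = t i * ∏ k, t k ^ content l k := by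
      simp only [content_cons, Pi.add_apply, pow_add, Finset.prod_mul_distrib]
      simp [Pi.single_apply, pow_ite]
    rw [word_cons, ← mul_assoc, h i (by simp), smul_mul_assoc, mul_assoc,
      ih fun k hk => h k (by simp [hk]), hprod, mul_smul_comm, smul_smul, mul_assoc]

section PBW

/-- The operator by which a generator acts on the vector space with basis the exponent vectors. -/
noncomputable def shift (q : Fin n → Fin n → F) (i : Fin n) :
    Module.End F ((Fin n → ℕ) →₀ F) :=
  Finsupp.linearCombination F fun ν : Fin n → ℕ =>
    Finsupp.single (Pi.single i 1 + ν) (∏ k ∈ Finset.Iio i, q i k ^ ν k)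

theorem shift_single (i : Fin n) (ν : Fin n → ℕ) (c : F) :
    shift q i (Finsupp.single ν c) =
      Finsupp.single (Pi.single i 1 + ν) (c * ∏ k ∈ Finset.Iio i, q i k ^ ν k) := by
  simp [shift, Finsupp.linearCombination_single]

theorem shift_mul_shift (hq : MultAntisym F q) {i j : Fin n} (h : i < j) :
    shift q i * shift q j = q i j • (shift q j * shift q i) := by
  refine Finsupp.lhom_ext fun ν c => ?_
  have h1 : ∏ k ∈ Finset.Iio i, q i k ^ (Pi.single j 1 + ν : Fin n → ℕ) k =
      ∏ k ∈ Finset.Iio i, q i k ^ ν k := by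
    refine Finset.prod_congr rfl fun k hk => ?_
    have : k ≠ j := ((Finset.mem_Iio.1 hk).trans h).ne
    simp [this]
  have h2 : ∏ k ∈ Finset.Iio j, q j k ^ (Pi.single i 1 + ν : Fin n → ℕ) k =
      q j i * ∏ k ∈ Finset.Iio j, q j k ^ ν k := by
    simp only [Pi.add_apply, pow_add, Finset.prod_mul_distrib]
    simp [Pi.single_apply, pow_ite, h]
  simp only [Module.End.mul_apply, LinearMap.smul_apply, shift_single, h1, h2,
    Finsupp.smul_single, smul_eq_mul]
  rw [add_left_comm, hq.2.2 i j]
  congr 1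
  field_simp [hq.1 i j]

theorem exists_linearMap_word (hq : MultAntisym F q) :
    ∃ f : QuantumAffineSpace F n q →ₗ[F] ((Fin n → ℕ) →₀ F),
      ∀ l, ∃ c : F, c ≠ 0 ∧ f (word q l) = Finsupp.single (content l) c := by
  obtain ⟨π, hπ⟩ := exists_algHom (q := q) (shift q) fun i j h => shift_mul_shift hq h
  refine ⟨(LinearMap.applyₗ (Finsupp.single 0 1)).comp π.toLinearMap, fun l => ?_⟩
  induction l with
  | nil => exact ⟨1, one_ne_zero, by simp⟩
  | cons i l ih =>
    obtain ⟨c, hc, h⟩ := ih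
    refine ⟨c * ∏ k ∈ Finset.Iio i, q i k ^ content l k,
      mul_ne_zero hc (Finset.prod_ne_zero_iff.2 fun k _ => pow_ne_zero _ (hq.1 i k)), ?_⟩
    simp only [LinearMap.coe_comp, Function.comp_apply, LinearMap.applyₗ_apply_apply,
      AlgHom.toLinearMap_apply] at h ⊢
    rw [word_cons, map_mul, Module.End.mul_apply, h, hπ, shift_single, content_cons]

theorem linearIndependent_monomial (hq : MultAntisym F q) :
    LinearIndependent F (monomial q) := by
  obtain ⟨f, hf⟩ := exists_linearMap_word hq
  refine LinearIndependent.of_comp f ?_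
  choose c hc h using fun ν : Fin n → ℕ => hf (stdWord ν)
  have : f ∘ monomial q = fun ν => (Units.mk0 (c ν) (hc ν)) • Finsupp.single ν (1 : F) := by
    funext ν
    simpa [monomial, Units.smul_def] using h ν
  rw [this]
  exact (Finsupp.basisSingleOne (R := F)).linearIndependent.units_smul _

/-- The span of a set of monomials whose exponents form a submonoid, as a subalgebra. -/
def monomialSubalgebra (hq : MultAntisym F q) (S : AddSubmonoid (Fin n → ℕ)) :
    Subalgebra F (QuantumAffineSpace F n q) :=
  (Submodule.span F (monomial q '' S)).toSubalgebra
    (Submodule.subset_span ⟨0, S.zero_mem, monomial_zero⟩) fun x y hx hy => by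
      have := Submodule.mul_mem_mul hx hy
      rw [Submodule.span_mul_span] at this
      refine Submodule.span_le.2 ?_ this
      rintro _ ⟨_, ⟨ν, hν, rfl⟩, _, ⟨μ, hμ, rfl⟩, rfl⟩
      obtain ⟨c, -, h⟩ := exists_monomial_mul_monomial hq ν μ
      simp only [h]
      exact Submodule.smul_mem _ _ (Submodule.subset_span ⟨_, S.add_mem hν hμ, rfl⟩)

theorem span_range_monomial (hq : MultAntisym F q) :
    ⊤ ≤ Submodule.span F (Set.range (monomial q)) := by
  have h : (⊤ : Subalgebra F (QuantumAffineSpace F n q)) ≤ monomialSubalgebra hq ⊤ := by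
    rw [← adjoin_range_QX, Algebra.adjoin_le_iff]
    rintro _ ⟨i, rfl⟩
    exact Submodule.subset_span ⟨Pi.single i 1, trivial, monomial_single i⟩
  intro x _
  have hx : x ∈ Submodule.span F (monomial q '' (⊤ : AddSubmonoid (Fin n → ℕ))) :=
    h (Algebra.mem_top (x := x))
  simpa using hx

/-- The Poincaré–Birkhoff–Witt basis of the quantum affine space. -/
noncomputable def basis (hq : MultAntisym F q) :
    Module.Basis (Fin n → ℕ) F (QuantumAffineSpace F n q) :=
  Module.Basis.mk (linearIndependent_monomial hq) (span_range_monomial hq)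

@[simp] theorem basis_apply (hq : MultAntisym F q) (ν : Fin n → ℕ) :
    basis hq ν = monomial q ν := by
  simp [basis]

@[simp] theorem repr_monomial (hq : MultAntisym F q) (ν : Fin n → ℕ) :
    (basis hq).repr (monomial q ν) = Finsupp.single ν 1 := by
  rw [← basis_apply hq, Module.Basis.repr_self]

@[simp] theorem repr_QX (hq : MultAntisym F q) (i : Fin n) :
    (basis hq).repr (QX F n q i) = Finsupp.single (Pi.single i 1) 1 := by
  rw [← monomial_single, repr_monomial]

end PBW

section Normal

/-- The linear map multiplying the monomial with exponent vector `ν` by `∏ k, t k ^ ν k`. -/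
noncomputable def scaling (hq : MultAntisym F q) (t : Fin n → F) :
    QuantumAffineSpace F n q →ₗ[F] QuantumAffineSpace F n q :=
  (basis hq).constr F fun ν => (∏ k, t k ^ ν k) • monomial q ν

theorem scaling_monomial (hq : MultAntisym F q) (t : Fin n → F) (ν : Fin n → ℕ) :
    scaling hq t (monomial q ν) = (∏ k, t k ^ ν k) • monomial q ν := by
  rw [← basis_apply hq, scaling, Module.Basis.constr_basis, basis_apply]

theorem repr_scaling (hq : MultAntisym F q) (t : Fin n → F) (x : QuantumAffineSpace F n q)
    (ν : Fin n → ℕ) :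
    (basis hq).repr (scaling hq t x) ν = (∏ k, t k ^ ν k) * (basis hq).repr x ν := by
  have : (basis hq).coord ν ∘ₗ scaling hq t = (∏ k, t k ^ ν k) • (basis hq).coord ν := by
    refine (basis hq).ext fun μ => ?_
    by_cases h : μ = ν
    · subst h
      simp [scaling_monomial]
    · simp [scaling_monomial, h]
  exact LinearMap.congr_fun this x

theorem mul_eq_scaling_mul (hq : MultAntisym F q) {t : Fin n → F} {z : QuantumAffineSpace F n q}
    (h : ∀ k, z * QX F n q k = t k • (QX F n q k * z)) (x : QuantumAffineSpace F n q) :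
    z * x = scaling hq t x * z := by
  have : LinearMap.mulLeft F z = LinearMap.mulRight F z ∘ₗ scaling hq t := by
    refine (basis hq).ext fun ν => ?_
    rw [basis_apply, LinearMap.mulLeft_apply, LinearMap.comp_apply, LinearMap.mulRight_apply,
      scaling_monomial, smul_mul_assoc]
    simpa [monomial] using mul_word (l := stdWord ν) fun k _ => h k
  exact LinearMap.congr_fun this x

theorem QX_mul (hq : MultAntisym F q) (i : Fin n) (x : QuantumAffineSpace F n q) :
    QX F n q i * x = scaling hq (q i) x * QX F n q i :=
  mul_eq_scaling_mul hq (QX_mul_QX hq i) x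

theorem mul_QX (hq : MultAntisym F q) (j : Fin n) (x : QuantumAffineSpace F n q) :
    x * QX F n q j = QX F n q j * scaling hq (fun k => q k j) x := by
  have : LinearMap.mulRight F (QX F n q j) =
      LinearMap.mulLeft F (QX F n q j) ∘ₗ scaling hq (fun k => q k j) := by
    refine (basis hq).ext fun ν => ?_
    have h : ∀ k, q k j * q j k = 1 := fun k => by
      rw [hq.2.2 j k, inv_mul_cancel₀ (hq.1 j k)]
    simp [scaling_monomial, QX_mul hq, smul_smul, ← Finset.prod_mul_distrib, ← mul_pow, h]
  exact LinearMap.congr_fun this x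

/-- The exponent vectors, ordered lexicographically. -/
def lexWeight (ν : Fin n → ℕ) : Lex (Fin n → ℤ) := toLex fun k => (ν k : ℤ)

theorem lexWeight_injective : Function.Injective (lexWeight (n := n)) := fun _ _ h =>
  funext fun k => Int.ofNat_injective (congrFun (toLex.injective h) k)

theorem lexWeight_add (ν μ : Fin n → ℕ) :
    lexWeight (ν + μ) = lexWeight ν + lexWeight μ := by
  rw [lexWeight, lexWeight, lexWeight, ← toLex_add]
  exact congrArg toLex (funext fun k => by simp)

theorem lexWeight_zero_le (ν : Fin n → ℕ) : lexWeight 0 ≤ lexWeight ν :=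
  Pi.toLex_monotone fun k => by simp

theorem mul_ne_zero (hq : MultAntisym F q) {x y : QuantumAffineSpace F n q} (hx : x ≠ 0)
    (hy : y ≠ 0) : x * y ≠ 0 := by
  obtain ⟨ν, hν⟩ := exists_isLeadingExponent (basis hq) lexWeight hx
  obtain ⟨μ, hμ⟩ := exists_isLeadingExponent (basis hq) lexWeight hy
  have := hν.mul lexWeight_injective lexWeight_add
    (by simpa using exists_monomial_mul_monomial hq) hμ
  intro h
  exact this.repr_ne_zero (by simp [h])

theorem QX_ne_zero (hq : MultAntisym F q) (i : Fin n) : QX F n q i ≠ 0 := by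
  rw [← monomial_single, ← basis_apply hq]
  exact (basis hq).ne_zero _

theorem isLeadingExponent_of_mul_eq_mul_QX (hq : MultAntisym F q) {Γ : Type*} [AddCommMonoid Γ]
    [LinearOrder Γ] [IsOrderedCancelAddMonoid Γ] {w : (Fin n → ℕ) → Γ}
    (hw : Function.Injective w) (hadd : ∀ ν μ, w (ν + μ) = w ν + w μ)
    {x z : QuantumAffineSpace F n q} {j : Fin n} (hz : z ≠ 0) (hx : x ≠ 0)
    (h : x * z = z * QX F n q j) :
    IsLeadingExponent (basis hq) w x (Pi.single j 1) := by
  have hmul : ∀ ν μ, ∃ c : F, c ≠ 0 ∧ basis hq ν * basis hq μ = c • basis hq (ν + μ) := by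
    simpa using exists_monomial_mul_monomial hq
  obtain ⟨ν, hν⟩ := exists_isLeadingExponent (basis hq) w hx
  obtain ⟨μ, hμ⟩ := exists_isLeadingExponent (basis hq) w hz
  have h1 := hν.mul hw hadd hmul hμ
  have h2 := hμ.mul hw hadd hmul (isLeadingExponent_basis (Pi.single j 1))
  rw [basis_apply, monomial_single, ← h, add_comm] at h2
  rwa [← add_right_cancel (h1.unique hw h2)]

/-- All monomials occurring in a normal element have the same commutation factor with each
generator. -/
theorem exists_commutation_factor (hq : MultAntisym F q) {x z : QuantumAffineSpace F n q}
    {j : Fin n} (hz : z ≠ 0) (h : x * z = z * QX F n q j) :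
    ∃ t : F, z * QX F n q j = t • (QX F n q j * z) ∧
      ∀ ν, (basis hq).repr z ν ≠ 0 → ∏ k, q k j ^ ν k = t := by
  have hx : x ≠ 0 := by
    rintro rfl
    exact mul_ne_zero hq hz (QX_ne_zero hq j) (by rw [← h, zero_mul])
  have h1 := isLeadingExponent_of_mul_eq_mul_QX hq lexWeight_injective lexWeight_add hz hx h
  have h2 := isLeadingExponent_of_mul_eq_mul_QX hq (w := fun ν => -lexWeight ν)
    (neg_injective.comp lexWeight_injective)
    (fun ν μ => by simp only [lexWeight_add, neg_add]) hz hx h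
  have hsupp : ∀ ν, ν ≠ Pi.single j 1 → (basis hq).repr x ν = 0 := fun ν hν => by
    by_contra h0
    exact hν (lexWeight_injective (le_antisymm (h1.le ν h0) (neg_le_neg_iff.1 (h2.le ν h0))))
  have hxj : x = (basis hq).repr x (Pi.single j 1) • QX F n q j := by
    refine (basis hq).ext_elem fun ν => ?_
    by_cases hν : ν = Pi.single j 1
    · simp [hν]
    · simp [hsupp ν hν, Finsupp.single_eq_of_ne hν]
  set t := (basis hq).repr x (Pi.single j 1)
  have hcomm : z * QX F n q j = t • (QX F n q j * z) := by
    rw [← h, ← smul_mul_assoc, ← hxj]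
  refine ⟨t, hcomm, fun ν hν => ?_⟩
  have hs : scaling hq (fun k => q k j) z = t • z := by
    by_contra hne
    refine mul_ne_zero hq (QX_ne_zero hq j) (sub_ne_zero.2 hne) ?_
    rw [mul_sub, ← mul_QX, mul_smul_comm, hcomm, sub_self]
  have := repr_scaling hq (fun k => q k j) z ν
  rw [hs, map_smul, Finsupp.smul_apply, smul_eq_mul] at this
  exact (mul_right_cancel₀ hν this).symm

end Normal

section Automorphism

variable (σ : QuantumAffineSpace F n q ≃ₐ[F] QuantumAffineSpace F n q)

theorem map_QX_ne_zero (hq : MultAntisym F q) (i : Fin n) : σ (QX F n q i) ≠ 0 :=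
  (map_ne_zero_iff σ σ.injective).2 (QX_ne_zero hq i)

theorem exists_commutation_factor_map (hq : MultAntisym F q) (i j : Fin n) :
    ∃ t : F, σ (QX F n q i) * QX F n q j = t • (QX F n q j * σ (QX F n q i)) ∧
      ∀ ν, (basis hq).repr (σ (QX F n q i)) ν ≠ 0 → ∏ k, q k j ^ ν k = t := by
  refine exists_commutation_factor hq (x := σ (scaling hq (q i) (σ.symm (QX F n q j))))
    (map_QX_ne_zero σ hq i) ?_
  rw [← map_mul, ← QX_mul, map_mul, AlgEquiv.apply_symm_apply]

theorem prod_pow_single (i j : Fin n) :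
    ∏ k, q k j ^ (Pi.single i 1 : Fin n → ℕ) k = q i j := by
  simp [Pi.single_apply, pow_ite]

theorem eq_of_repr_map_single_ne_zero (hq : MultAntisym F q) (h1 : ∀ i j, i ≠ j → q i j ≠ 1)
    {i k l : Fin n} (hk : (basis hq).repr (σ (QX F n q i)) (Pi.single k 1) ≠ 0)
    (hl : (basis hq).repr (σ (QX F n q i)) (Pi.single l 1) ≠ 0) : k = l := by
  by_contra hne
  obtain ⟨t, -, ht⟩ := exists_commutation_factor_map σ hq i l
  have hk' := ht _ hk
  have hl' := ht _ hl
  rw [prod_pow_single] at hk' hl'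
  exact h1 k l hne (by rw [hk', ← hl', hq.2.1])

theorem eq_zero_or_eq_zero_of_add_eq_single {k : Fin n} {ν μ : Fin n → ℕ}
    (h : ν + μ = Pi.single k 1) : ν = 0 ∨ μ = 0 := by
  have hk : ∀ l, ν l + μ l = if l = k then 1 else 0 := fun l => by
    rw [← Pi.add_apply, h, Pi.single_apply]
  have hkk : ν k + μ k = 1 := by simpa using hk k
  rcases Nat.eq_zero_or_pos (ν k) with h0 | _
  · left
    ext l
    have := hk l
    split_ifs at this with hl
    · rw [hl, h0, Pi.zero_apply]
    · simp only [Pi.zero_apply]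
      omega
  · right
    ext l
    have := hk l
    split_ifs at this with hl
    · rw [hl, Pi.zero_apply]
      omega
    · simp only [Pi.zero_apply]
      omega

/-- The exponent vectors other than a given unit vector. -/
def offSingle (k : Fin n) : AddSubmonoid (Fin n → ℕ) where
  carrier := {ν | ν ≠ Pi.single k 1}
  zero_mem' h := by simpa using congrFun h k
  add_mem' {ν μ} hν hμ h := by
    rcases eq_zero_or_eq_zero_of_add_eq_single h with rfl | rfl
    · exact hμ (by simpa using h)
    · exact hν (by simpa using h)

theorem mem_span_monomial_iff (hq : MultAntisym F q) (S : Set (Fin n → ℕ))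
    (x : QuantumAffineSpace F n q) :
    x ∈ Submodule.span F (monomial q '' S) ↔ ∀ ν, (basis hq).repr x ν ≠ 0 → ν ∈ S := by
  have h : monomial q = basis hq := funext fun ν => (basis_apply hq ν).symm
  rw [h, Module.Basis.mem_span_image]
  simp [Set.subset_def]

theorem exists_repr_map_single_ne_zero (hq : MultAntisym F q) (k : Fin n) :
    ∃ i, (basis hq).repr (σ (QX F n q i)) (Pi.single k 1) ≠ 0 := by
  by_contra! h
  have hle : (⊤ : Subalgebra F (QuantumAffineSpace F n q)) ≤
      monomialSubalgebra hq (offSingle k) := by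
    rw [← (AlgHom.range_eq_top σ.toAlgHom).2 σ.surjective, ← Algebra.map_top,
      ← adjoin_range_QX, AlgHom.map_adjoin, Algebra.adjoin_le_iff]
    rintro _ ⟨_, ⟨i, rfl⟩, rfl⟩
    refine (mem_span_monomial_iff hq _ _).2 fun ν hν hνk => ?_
    rw [hνk] at hν
    exact hν (h i)
  have hk := (mem_span_monomial_iff hq _ _).1 (hle (Algebra.mem_top (x := QX F n q k)))
  exact hk (Pi.single k 1) (by simp) rfl

theorem exists_eq_QX_mul (hq : MultAntisym F q) {i : Fin n} {x : QuantumAffineSpace F n q}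
    (hx : ∀ ν, (basis hq).repr x ν ≠ 0 → ν i ≠ 0) : ∃ z, x = QX F n q i * z := by
  have h := (mem_span_monomial_iff hq {ν | ν i ≠ 0} x).2 hx
  have hle : Submodule.span F (monomial q '' {ν | ν i ≠ 0}) ≤
      LinearMap.range (LinearMap.mulLeft F (QX F n q i)) := by
    refine Submodule.span_le.2 ?_
    rintro _ ⟨ν, hν, rfl⟩
    obtain ⟨c, hc, h⟩ := exists_monomial_mul_monomial hq (Pi.single i 1) (ν - Pi.single i 1)
    have hadd : Pi.single i 1 + (ν - Pi.single i 1) = ν := by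
      refine add_tsub_cancel_of_le fun k => ?_
      by_cases hk : k = i
      · subst hk
        simpa using Nat.one_le_iff_ne_zero.2 hν
      · simp [hk]
    rw [hadd, monomial_single] at h
    exact ⟨c⁻¹ • monomial q (ν - Pi.single i 1), by
      rw [LinearMap.mulLeft_apply, mul_smul_comm, h, smul_smul, inv_mul_cancel₀ hc, one_smul]⟩
  obtain ⟨z, hz⟩ := hle h
  exact ⟨z, hz.symm⟩

theorem eq_smul_one_of_isLeadingExponent_zero (hq : MultAntisym F q)
    {x : QuantumAffineSpace F n q} (hx : IsLeadingExponent (basis hq) lexWeight x 0) :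
    x = (basis hq).repr x 0 • 1 := by
  refine (basis hq).ext_elem fun ν => ?_
  rw [← monomial_zero, map_smul, repr_monomial, Finsupp.smul_apply, smul_eq_mul]
  by_cases hν : ν = 0
  · simp [hν]
  · rw [Finsupp.single_eq_of_ne hν, mul_zero]
    by_contra h
    exact hν (lexWeight_injective (le_antisymm (hx.le ν h) (lexWeight_zero_le ν)))

/-- The generators are irreducible, the units being scalars. -/
theorem exists_eq_smul_one_of_mul_eq_QX (hq : MultAntisym F q) {x y : QuantumAffineSpace F n q}
    {i : Fin n} (h : x * y = QX F n q i) : (∃ c : F, x = c • 1) ∨ ∃ c : F, y = c • 1 := by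
  have hx : x ≠ 0 := by
    rintro rfl
    exact QX_ne_zero hq i (by rw [← h, zero_mul])
  have hy : y ≠ 0 := by
    rintro rfl
    exact QX_ne_zero hq i (by rw [← h, mul_zero])
  obtain ⟨ν, hν⟩ := exists_isLeadingExponent (basis hq) lexWeight hx
  obtain ⟨μ, hμ⟩ := exists_isLeadingExponent (basis hq) lexWeight hy
  have h1 := hν.mul lexWeight_injective lexWeight_add
    (by simpa using exists_monomial_mul_monomial hq) hμ
  have h2 : IsLeadingExponent (basis hq) lexWeight (x * y) (Pi.single i 1) := by
    rw [h, ← monomial_single, ← basis_apply hq]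
    exact isLeadingExponent_basis _
  rcases eq_zero_or_eq_zero_of_add_eq_single (h1.unique lexWeight_injective h2) with rfl | rfl
  · exact Or.inl ⟨_, eq_smul_one_of_isLeadingExponent_zero hq hν⟩
  · exact Or.inr ⟨_, eq_smul_one_of_isLeadingExponent_zero hq hμ⟩

/-- The linear part of an automorphism permutes the generators up to scalars. -/
theorem exists_perm (hq : MultAntisym F q) (h1 : ∀ i j, i ≠ j → q i j ≠ 1) :
    ∃ τ : Equiv.Perm (Fin n), (∀ i j, q i j = q (τ i) (τ j)) ∧
      ∀ i, (basis hq).repr (σ (QX F n q i)) (Pi.single (τ i) 1) ≠ 0 := by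
  choose f hf using exists_repr_map_single_ne_zero σ hq
  have hinj : Function.Injective f := fun k l hkl =>
    eq_of_repr_map_single_ne_zero σ hq h1 (hf k) (hkl ▸ hf l)
  set e := Equiv.ofBijective f (Finite.injective_iff_bijective.1 hinj)
  have hτ : ∀ i, (basis hq).repr (σ (QX F n q i)) (Pi.single (e.symm i) 1) ≠ 0 := fun i => by
    have := hf (e.symm i)
    rwa [show f (e.symm i) = i from e.apply_symm_apply i] at this
  refine ⟨e.symm, fun j i => ?_, hτ⟩
  have hcomm : ∀ l, σ (QX F n q j) * QX F n q l =
      q (e.symm j) l • (QX F n q l * σ (QX F n q j)) := fun l => by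
    obtain ⟨t, h, ht⟩ := exists_commutation_factor_map σ hq j l
    rw [h, ← ht _ (hτ j), prod_pow_single]
  have hs : scaling hq (q (e.symm j)) (σ (QX F n q i)) = q j i • σ (QX F n q i) := by
    by_contra hne
    refine mul_ne_zero hq (sub_ne_zero.2 hne) (map_QX_ne_zero σ hq j) ?_
    rw [sub_mul, ← mul_eq_scaling_mul hq hcomm, ← map_mul, QX_mul_QX hq j i, map_smul, map_mul,
      smul_mul_assoc, sub_self]
  have := repr_scaling hq (q (e.symm j)) (σ (QX F n q i)) (Pi.single (e.symm i) 1)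
  rw [hs, map_smul, Finsupp.smul_apply, smul_eq_mul] at this
  rw [mul_right_cancel₀ (hτ i) this]
  simp [Pi.single_apply, pow_ite]

theorem isScalarAut_of_lambdaEmpty (hq : MultAntisym F q) (hE : LambdaEmpty F q)
    (h : ∀ i, (basis hq).repr (σ (QX F n q i)) (Pi.single i 1) ≠ 0) : IsScalarAut F n q σ := by
  have key : ∀ i, ∃ c : F, c ≠ 0 ∧ σ (QX F n q i) = c • QX F n q i := by
    intro i
    obtain ⟨z, hz⟩ := exists_eq_QX_mul (i := i) (x := σ (QX F n q i)) hq fun ν hν hνi => by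
      refine hE i ν ⟨hνi, fun j _ => ?_⟩
      obtain ⟨t, -, ht⟩ := exists_commutation_factor_map σ hq i j
      rw [ht ν hν, ← ht _ (h i), prod_pow_single]
    have hfac : σ.symm (QX F n q i) * σ.symm z = QX F n q i := by
      rw [← map_mul, ← hz, AlgEquiv.symm_apply_apply]
    rcases exists_eq_smul_one_of_mul_eq_QX hq hfac with ⟨c, hc⟩ | ⟨c, hc⟩
    · have hX : QX F n q i = c • monomial q 0 := by
        rw [← σ.apply_symm_apply (QX F n q i), hc, map_smul, map_one, monomial_zero]
      have := congrArg (fun x => (basis hq).repr x (Pi.single i 1)) hX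
      simp at this
    · have hz' : z = c • 1 := by
        rw [← σ.apply_symm_apply z, hc, map_smul, map_one]
      rw [hz', mul_smul_comm, mul_one] at hz
      refine ⟨c, ?_, hz⟩
      rintro rfl
      exact map_QX_ne_zero σ hq i (by rw [hz, zero_smul])
  choose a ha h' using key
  exact ⟨a, ha, h'⟩

theorem exists_permAut (hq : MultAntisym F q) (τ : Equiv.Perm (Fin n))
    (hτ : ∀ i j, q i j = q (τ i) (τ j)) :
    ∃ σ : QuantumAffineSpace F n q ≃ₐ[F] QuantumAffineSpace F n q,
      ∀ i, σ (QX F n q i) = QX F n q (τ i) := by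
  obtain ⟨f, hf⟩ := exists_algHom (q := q) (fun i => QX F n q (τ i)) fun i j _ => by
    rw [QX_mul_QX hq, hτ i j]
  obtain ⟨g, hg⟩ := exists_algHom (q := q) (fun i => QX F n q (τ.symm i)) fun i j _ => by
    rw [QX_mul_QX hq, hτ (τ.symm i), Equiv.apply_symm_apply, Equiv.apply_symm_apply]
  exact ⟨AlgEquiv.ofAlgHom f g (algHom_ext fun i => by simp [hf, hg])
    (algHom_ext fun i => by simp [hf, hg]), hf⟩

/-- The endomorphism adding a multiple of a monomial to one generator. -/
theorem exists_elementary_algHom (hq : MultAntisym F q) {i : Fin n} {ν : Fin n → ℕ}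
    (hν : ∀ j, j ≠ i → ∏ k, q k j ^ ν k = q i j) (c : F) :
    ∃ f : QuantumAffineSpace F n q →ₐ[F] QuantumAffineSpace F n q,
      f (QX F n q i) = QX F n q i + c • monomial q ν ∧
        ∀ j, j ≠ i → f (QX F n q j) = QX F n q j := by
  have hcomm : ∀ j, j ≠ i → monomial q ν * QX F n q j = q i j • (QX F n q j * monomial q ν) :=
    fun j hj => by rw [mul_QX hq, scaling_monomial, hν j hj, mul_smul_comm]
  have hcomm' : ∀ j, j ≠ i → QX F n q j * monomial q ν = q j i • (monomial q ν * QX F n q j) :=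
    fun j hj => by
      rw [hcomm j hj, smul_smul, hq.2.2 i j, inv_mul_cancel₀ (hq.1 i j), one_smul]
  obtain ⟨f, hf⟩ := exists_algHom (q := q)
    (Function.update (QX F n q) i (QX F n q i + c • monomial q ν)) fun j k hjk => by
      by_cases hj : j = i
      · subst hj
        rw [Function.update_self, Function.update_of_ne hjk.ne']
        rw [add_mul, mul_add, smul_add, QX_mul_QX hq, smul_mul_assoc, hcomm k hjk.ne',
          mul_smul_comm, smul_comm]
      · rw [Function.update_of_ne hj]
        by_cases hk : k = i
        · subst hk
          rw [Function.update_self, add_mul, mul_add, smul_add, QX_mul_QX hq, smul_mul_assoc,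
            mul_smul_comm, hcomm' j hj, smul_comm]
        · rw [Function.update_of_ne hk, QX_mul_QX hq]
  exact ⟨f, by simp [hf], fun j hj => by simp [hf, hj]⟩

theorem map_monomial_of_eq_zero {f : QuantumAffineSpace F n q →ₐ[F] QuantumAffineSpace F n q}
    {i : Fin n} (hf : ∀ j, j ≠ i → f (QX F n q j) = QX F n q j) {ν : Fin n → ℕ} (hν : ν i = 0) :
    f (monomial q ν) = monomial q ν := by
  rw [monomial, word, map_list_prod, List.map_map]
  congr 1
  refine List.map_congr_left fun k hk => hf k ?_
  rintro rfl
  rw [← content_stdWord ν] at hν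
  exact List.count_eq_zero.1 hν hk

theorem exists_elementaryAut (hq : MultAntisym F q) {i : Fin n} {ν : Fin n → ℕ} (hi : ν i = 0)
    (hν : ∀ j, j ≠ i → ∏ k, q k j ^ ν k = q i j) :
    ∃ σ : QuantumAffineSpace F n q ≃ₐ[F] QuantumAffineSpace F n q,
      σ (QX F n q i) = QX F n q i + monomial q ν := by
  obtain ⟨f, hfi, hf⟩ := exists_elementary_algHom hq hν 1
  obtain ⟨g, hgi, hg⟩ := exists_elementary_algHom hq hν (-1)
  have hcancel : monomial q ν + (-1 : F) • monomial q ν = 0 := by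
    nth_rw 1 [← one_smul F (monomial q ν)]
    rw [← add_smul, add_neg_cancel, zero_smul]
  have hcancel' := (add_comm _ _).trans hcancel
  refine ⟨AlgEquiv.ofAlgHom f g (algHom_ext fun j => ?_) (algHom_ext fun j => ?_), ?_⟩
  · by_cases hj : j = i
    · subst hj
      simp [hfi, hgi, map_monomial_of_eq_zero hf hi, add_assoc, hcancel]
    · simp [hf j hj, hg j hj]
  · by_cases hj : j = i
    · subst hj
      simp [hfi, hgi, map_monomial_of_eq_zero hg hi, add_assoc, hcancel']
    · simp [hf j hj, hg j hj]
  · simpa using hfi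

end Automorphism

end QuantumAffineSpace

open QuantumAffineSpace

theorem triviality_of_aut_no_entry_one (F : Type*) [Field F] [CharZero F]
    (n : ℕ) (hn : 3 ≤ n) (q : Fin n → Fin n → F) (hq : MultAntisym F q)
    (hq1 : ∀ i j : Fin n, i < j → q i j ≠ 1) :
    (∀ σ : QuantumAffineSpace F n q ≃ₐ[F] QuantumAffineSpace F n q, IsScalarAut F n q σ) ↔
      (LambdaEmpty F q ∧
        ∀ σ : Equiv.Perm (Fin n), (∀ i j : Fin n, i < j → q i j = q (σ i) (σ j)) → σ = 1) := by
  have h1 : ∀ i j, i ≠ j → q i j ≠ 1 := fun i j hij => by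
    rcases lt_or_gt_of_ne hij with h | h
    · exact hq1 i j h
    · rw [hq.2.2 j i]
      exact inv_ne_one.2 (hq1 j i h)
  refine ⟨fun h => ⟨fun i ν hν => ?_, fun τ hτ => ?_⟩, fun ⟨hE, hperm⟩ σ => ?_⟩
  · obtain ⟨σ, hσ⟩ := exists_elementaryAut hq hν.1 hν.2
    obtain ⟨a, -, ha⟩ := h σ
    have hne : ν ≠ Pi.single i 1 := by
      rintro rfl
      simpa using hν.1
    have := congrArg (fun x => (basis hq).repr x ν) (hσ.symm.trans (ha i))
    simp [Finsupp.single_eq_of_ne hne] at this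
  · have hτ' : ∀ i j, q i j = q (τ i) (τ j) := fun i j => by
      rcases lt_trichotomy i j with h | rfl | h
      · exact hτ i j h
      · rw [hq.2.1, hq.2.1]
      · rw [hq.2.2 j i, hτ j i h, hq.2.2 (τ j) (τ i)]
    obtain ⟨σ, hσ⟩ := exists_permAut hq τ hτ'
    obtain ⟨a, -, ha⟩ := h σ
    refine Equiv.ext fun i => ?_
    by_contra hne
    have := congrArg (fun x => (basis hq).repr x (Pi.single (τ i) 1)) ((hσ i).symm.trans (ha i))
    have hs : (Pi.single (τ i) 1 : Fin n → ℕ) ≠ Pi.single i 1 := fun h => by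
      have := congrFun h (τ i)
      rw [Equiv.Perm.one_apply] at hne
      rw [Pi.single_eq_same, Pi.single_eq_of_ne hne] at this
      exact one_ne_zero this
    simp [Finsupp.single_eq_of_ne hs] at this
  · obtain ⟨τ, hτ, hsupp⟩ := exists_perm σ hq h1
    obtain rfl := hperm τ fun i j _ => hτ i j
    exact isScalarAut_of_lambdaEmpty σ hq hE hsupp
end

section
/- Let 𝔽 be a field, let n ≥ 3, and let 𝔮 = (q_{ij}) be a multiplicatively antisymmetric n×n matrix over 𝔽 whose λ-group Λ is torsion-free of rank at least c := (n−1)(n−2)/2 + 1 (that is, Λ is torsion-free and contains c multiplicatively independent elements; equivalently, Λ is a free abelian group of rank at least c). Then every 𝔽-algebra automorphism of the quantum affine space 𝒪_𝔮 is scalar. -/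
namespace QuantumAffine

variable {F : Type*} [Field F] {n : ℕ} {q : Fin n → Fin n → F}

theorem QX_mul_QX (hq : MultAntisym F q) (i j : Fin n) :
    QX F n q i * QX F n q j = q i j • (QX F n q j * QX F n q i) := by
  have key : ∀ i j : Fin n, i < j →
      QX F n q i * QX F n q j = q i j • (QX F n q j * QX F n q i) := fun i j h => by
    simpa [QX] using RingQuot.mkAlgHom_rel F (QuantumRel.rel (q := q) i j h)
  rcases lt_trichotomy i j with h | rfl | h
  · exact key i j h
  · simp [hq.2.1]
  · rw [key j i h, smul_smul, hq.2.2 j i, inv_mul_cancel₀ (hq.1 j i), one_smul]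

/-- The product of generators along a word. -/
noncomputable def wordProd (q : Fin n → Fin n → F) (w : List (Fin n)) :
    QuantumAffineSpace F n q :=
  (w.map (QX F n q)).prod

theorem wordProd_cons (i : Fin n) (w : List (Fin n)) :
    wordProd q (i :: w) = QX F n q i * wordProd q w := by
  simp [wordProd]

theorem wordProd_append (w w' : List (Fin n)) :
    wordProd q (w ++ w') = wordProd q w * wordProd q w' := by
  simp [wordProd]

theorem wordProd_perm (hq : MultAntisym F q) {w w' : List (Fin n)} (h : w.Perm w') :
    ∃ c : F, c ≠ 0 ∧ wordProd q w = c • wordProd q w' := by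
  induction h with
  | nil => exact ⟨1, one_ne_zero, by simp⟩
  | cons x _ ih =>
    obtain ⟨c, hc, h⟩ := ih
    exact ⟨c, hc, by simp [wordProd_cons, h]⟩
  | swap x y l =>
    refine ⟨q y x, hq.1 _ _, ?_⟩
    simp only [wordProd_cons, ← mul_assoc]
    rw [QX_mul_QX hq y x, smul_mul_assoc]
  | trans _ _ ih ih' =>
    obtain ⟨c, hc, h⟩ := ih
    obtain ⟨d, hd, h'⟩ := ih'
    exact ⟨c * d, mul_ne_zero hc hd, by rw [h, h', smul_smul]⟩

theorem QX_mul_wordProd (hq : MultAntisym F q) (j : Fin n) (w : List (Fin n)) :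
    QX F n q j * wordProd q w = (w.map (q j)).prod • (wordProd q w * QX F n q j) := by
  induction w with
  | nil => simp [wordProd]
  | cons i w ih =>
    rw [wordProd_cons, ← mul_assoc, QX_mul_QX hq, smul_mul_assoc, mul_assoc, ih]
    simp [smul_smul, mul_assoc]

/-- The scalar by which `X i` acts on the monomial with exponent `m` in normal form. -/
def leftFactor (q : Fin n → Fin n → F) (i : Fin n) (m : Multiset (Fin n)) : F :=
  ((m.filter (· < i)).map (q i)).prod

theorem leftFactor_ne_zero (hq : MultAntisym F q) (i : Fin n) (m : Multiset (Fin n)) :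
    leftFactor q i m ≠ 0 := by
  simp [leftFactor, Multiset.prod_eq_zero_iff, hq.1]

/-- Left multiplication by `X i` on the space of commutative polynomials. -/
noncomputable def leftOp (q : Fin n → Fin n → F) (i : Fin n) :
    Module.End F (Multiset (Fin n) →₀ F) :=
  Finsupp.linearCombination F fun m => Finsupp.single (i ::ₘ m) (leftFactor q i m)

theorem leftOp_single (i : Fin n) (m : Multiset (Fin n)) (c : F) :
    leftOp q i (Finsupp.single m c) = Finsupp.single (i ::ₘ m) (c * leftFactor q i m) := by
  simp [leftOp]

/-- The regular representation of the quantum affine space on commutative polynomials. -/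
noncomputable def regularRep (hq : MultAntisym F q) :
    QuantumAffineSpace F n q →ₐ[F] Module.End F (Multiset (Fin n) →₀ F) :=
  RingQuot.liftAlgHom F ⟨FreeAlgebra.lift F (leftOp q), by
    rintro _ _ ⟨i, j, h⟩
    simp only [map_mul, map_smul, FreeAlgebra.lift_ι_apply]
    refine Finsupp.lhom_ext fun m c => ?_
    simp only [Module.End.mul_apply, LinearMap.smul_apply, leftOp_single, Finsupp.smul_single,
      smul_eq_mul, Multiset.cons_swap j i]
    congr 1
    have h₁ : leftFactor q i (j ::ₘ m) = leftFactor q i m := by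
      rw [leftFactor, Multiset.filter_cons_of_neg (p := (· < i)) m h.not_gt, leftFactor]
    have h₂ : leftFactor q j (i ::ₘ m) = q j i * leftFactor q j m := by
      simp [leftFactor, Multiset.filter_cons_of_pos (p := (· < j)) m h]
    rw [h₁, h₂, hq.2.2 i j]
    field_simp [hq.1 i j]⟩

theorem regularRep_QX (hq : MultAntisym F q) (i : Fin n) :
    regularRep hq (QX F n q i) = leftOp q i := by
  simp [regularRep, QX]

theorem regularRep_wordProd (hq : MultAntisym F q) (w : List (Fin n)) :
    ∃ c : F, c ≠ 0 ∧
      regularRep hq (wordProd q w) (Finsupp.single 0 1) = Finsupp.single (w : Multiset _) c := by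
  induction w with
  | nil => exact ⟨1, one_ne_zero, by simp [wordProd]⟩
  | cons i w ih =>
    obtain ⟨c, hc, h⟩ := ih
    refine ⟨c * leftFactor q i w, mul_ne_zero hc (leftFactor_ne_zero hq _ _), ?_⟩
    rw [wordProd_cons, map_mul, Module.End.mul_apply, h, regularRep_QX, leftOp_single]
    rfl

/-- The monomial with exponent `m`. -/
noncomputable def monomial (q : Fin n → Fin n → F) (m : Multiset (Fin n)) :
    QuantumAffineSpace F n q :=
  wordProd q m.toList

theorem wordProd_eq_smul_monomial (hq : MultAntisym F q) (w : List (Fin n)) :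
    ∃ c : F, c ≠ 0 ∧ wordProd q w = c • monomial q (w : Multiset (Fin n)) :=
  wordProd_perm hq (Multiset.coe_eq_coe.1 (Multiset.coe_toList _).symm)

theorem monomial_singleton (i : Fin n) : monomial q {i} = QX F n q i := by
  simp [monomial, wordProd]

theorem linearIndependent_monomial (hq : MultAntisym F q) :
    LinearIndependent F (monomial q) := by
  choose c hc h using fun m : Multiset (Fin n) => regularRep_wordProd hq m.toList
  refine LinearIndependent.of_comp
    ((LinearMap.applyₗ (Finsupp.single 0 1)).comp (regularRep hq).toLinearMap) ?_
  have hli := (Finsupp.basisSingleOne (R := F) (ι := Multiset (Fin n))).linearIndependent.units_smul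
    fun m => Units.mk0 (c m) (hc m)
  convert hli using 1
  ext1 m
  simp [monomial, h, Units.smul_def]

theorem span_monomial (hq : MultAntisym F q) :
    ⊤ ≤ Submodule.span F (Set.range (monomial q)) := by
  set S := Submodule.span F (Set.range (monomial q))
  have hword : ∀ w, wordProd q w ∈ S := fun w => by
    obtain ⟨c, -, h⟩ := wordProd_eq_smul_monomial hq w
    exact h ▸ S.smul_mem c (Submodule.subset_span ⟨_, rfl⟩)
  have hmul : ∀ a b, a ∈ S → b ∈ S → a * b ∈ S := fun a b ha hb => by
    have : a * b ∈ S * S := Submodule.mul_mem_mul ha hb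
    refine Submodule.mul_le.2 (fun x hx y hy => ?_) this
    have hxy : x * y ∈ S * S := Submodule.mul_mem_mul hx hy
    rw [Submodule.span_mul_span] at hxy
    refine Submodule.span_le.2 ?_ hxy
    rintro _ ⟨_, ⟨m, rfl⟩, _, ⟨m', rfl⟩, rfl⟩
    have := hword (m.toList ++ m'.toList)
    rwa [wordProd_append] at this
  have hone : (1 : QuantumAffineSpace F n q) ∈ S := by simpa [wordProd] using hword []
  intro x _
  obtain ⟨y, rfl⟩ := RingQuot.mkAlgHom_surjective F (QuantumRel F n q) x
  induction y using FreeAlgebra.induction with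
  | grade0 r =>
    rw [AlgHom.commutes, Algebra.algebraMap_eq_smul_one]
    exact S.smul_mem _ hone
  | grade1 i => simpa [wordProd, QX] using hword [i]
  | mul a b ha hb => rw [map_mul]; exact hmul _ _ (ha trivial) (hb trivial)
  | add a b ha hb => rw [map_add]; exact S.add_mem (ha trivial) (hb trivial)

/-- The basis of monomials. -/
noncomputable def monomialBasis (hq : MultAntisym F q) :
    Module.Basis (Multiset (Fin n)) F (QuantumAffineSpace F n q) :=
  Module.Basis.mk (linearIndependent_monomial hq) (span_monomial hq)

theorem monomialBasis_apply (hq : MultAntisym F q) (m : Multiset (Fin n)) :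
    monomialBasis hq m = monomial q m := by
  simp [monomialBasis]

theorem monomial_mul (hq : MultAntisym F q) (m m' : Multiset (Fin n)) :
    ∃ c : F, c ≠ 0 ∧ monomial q m * monomial q m' = c • monomial q (m + m') := by
  obtain ⟨c, hc, h⟩ := wordProd_eq_smul_monomial hq (m.toList ++ m'.toList)
  refine ⟨c, hc, ?_⟩
  rw [wordProd_append, ← Multiset.coe_add, Multiset.coe_toList, Multiset.coe_toList] at h
  exact h

theorem QX_mul_monomial (hq : MultAntisym F q) (j : Fin n) (m : Multiset (Fin n)) :
    QX F n q j * monomial q m = (m.map (q j)).prod • (monomial q m * QX F n q j) := by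
  have := QX_mul_wordProd hq j m.toList
  rwa [← Multiset.prod_coe, ← Multiset.map_coe, Multiset.coe_toList] at this

theorem exists_mul_eq_QX_mul (hq : MultAntisym F q) (i : Fin n) (x : QuantumAffineSpace F n q) :
    ∃ y, x * QX F n q i = QX F n q i * y := by
  induction span_monomial hq (Submodule.mem_top (x := x)) using Submodule.span_induction with
  | mem _ h =>
    obtain ⟨m, rfl⟩ := h
    have hne : (m.map (q i)).prod ≠ 0 := by simp [Multiset.prod_eq_zero_iff, hq.1]
    refine ⟨((m.map (q i)).prod)⁻¹ • monomial q m, ?_⟩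
    rw [mul_smul_comm, QX_mul_monomial hq, smul_smul, inv_mul_cancel₀ hne, one_smul]
  | zero => exact ⟨0, by simp⟩
  | add a b _ _ ha hb =>
    obtain ⟨y, hy⟩ := ha
    obtain ⟨z, hz⟩ := hb
    exact ⟨y + z, by rw [add_mul, mul_add, hy, hz]⟩
  | smul c a _ ha =>
    obtain ⟨y, hy⟩ := ha
    exact ⟨c • y, by rw [smul_mul_assoc, hy, mul_smul_comm]⟩

theorem repr_monomial_mul (hq : MultAntisym F q) (u v t : Multiset (Fin n)) (h : u + v ≠ t) :
    (monomialBasis hq).repr (monomial q u * monomial q v) t = 0 := by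
  obtain ⟨c, -, hc⟩ := monomial_mul hq u v
  rw [hc, ← monomialBasis_apply hq, map_smul, Module.Basis.repr_self]
  simp [h]

theorem repr_mul (hq : MultAntisym F q) (f g : QuantumAffineSpace F n q)
    (t : Multiset (Fin n)) :
    (monomialBasis hq).repr (f * g) t =
      ∑ u ∈ ((monomialBasis hq).repr f).support, ∑ v ∈ ((monomialBasis hq).repr g).support,
        (monomialBasis hq).repr f u * ((monomialBasis hq).repr g v *
          (monomialBasis hq).repr (monomial q u * monomial q v) t) := by
  set b := monomialBasis hq
  conv_lhs => rw [← b.linearCombination_repr f, ← b.linearCombination_repr g]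
  simp only [Finsupp.linearCombination_apply, Finsupp.sum, Finset.sum_mul_sum, map_sum,
    Finsupp.finsetSum_apply, smul_mul_smul_comm, map_smul, Finsupp.smul_apply, smul_eq_mul,
    mul_assoc, b, monomialBasis_apply]

theorem exists_of_repr_mul_ne_zero (hq : MultAntisym F q) {f g : QuantumAffineSpace F n q}
    {t : Multiset (Fin n)} (h : (monomialBasis hq).repr (f * g) t ≠ 0) :
    ∃ u v, (monomialBasis hq).repr f u ≠ 0 ∧ (monomialBasis hq).repr g v ≠ 0 ∧ u + v = t := by
  rw [repr_mul] at h
  obtain ⟨u, hu, h⟩ := Finset.exists_ne_zero_of_sum_ne_zero h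
  obtain ⟨v, hv, h⟩ := Finset.exists_ne_zero_of_sum_ne_zero h
  refine ⟨u, v, Finsupp.mem_support_iff.1 hu, Finsupp.mem_support_iff.1 hv, ?_⟩
  by_contra hne
  exact h (by rw [repr_monomial_mul hq u v t hne]; simp)

theorem repr_mul_of_unique (hq : MultAntisym F q) {f g : QuantumAffineSpace F n q}
    {u v : Multiset (Fin n)}
    (h : ∀ u' v', (monomialBasis hq).repr f u' ≠ 0 → (monomialBasis hq).repr g v' ≠ 0 →
      u' + v' = u + v → u' = u ∧ v' = v) :
    (monomialBasis hq).repr (f * g) (u + v) = (monomialBasis hq).repr f u *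
      ((monomialBasis hq).repr g v *
        (monomialBasis hq).repr (monomial q u * monomial q v) (u + v)) := by
  rw [repr_mul, Finset.sum_eq_single u, Finset.sum_eq_single v]
  · intro v' hv' hne
    by_cases hu : (monomialBasis hq).repr f u = 0
    · simp [hu]
    rw [repr_monomial_mul hq, mul_zero, mul_zero]
    exact fun he => hne (h u v' hu (Finsupp.mem_support_iff.1 hv') he).2
  · intro hv
    simp [Finsupp.notMem_support_iff.1 hv]
  · intro u' hu' hne
    refine Finset.sum_eq_zero fun v' hv' => ?_
    rw [repr_monomial_mul hq, mul_zero, mul_zero]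
    exact fun he =>
      hne (h u' v' (Finsupp.mem_support_iff.1 hu') (Finsupp.mem_support_iff.1 hv') he).1
  · intro hu
    simp [Finsupp.notMem_support_iff.1 hu]

theorem repr_monomial_mul_ne_zero (hq : MultAntisym F q) (u v : Multiset (Fin n)) :
    (monomialBasis hq).repr (monomial q u * monomial q v) (u + v) ≠ 0 := by
  obtain ⟨c, hc, h⟩ := monomial_mul hq u v
  rw [h, ← monomialBasis_apply hq, map_smul, Module.Basis.repr_self]
  simpa using hc

theorem repr_QX (hq : MultAntisym F q) (j : Fin n) :
    (monomialBasis hq).repr (QX F n q j) = Finsupp.single {j} 1 := by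
  rw [← monomial_singleton, ← monomialBasis_apply hq, Module.Basis.repr_self]

/-- If `X j * f = f * g`, the support of `g` is bounded by `{j}` in every monomial order. -/
theorem support_le_of_QX_mul_eq {Γ : Type*} [AddCommMonoid Γ] [LinearOrder Γ]
    [IsOrderedCancelAddMonoid Γ] (φ : Multiset (Fin n) →+ Γ) (hφ : Function.Injective φ)
    (hq : MultAntisym F q) {f g : QuantumAffineSpace F n q} (hf : f ≠ 0) {j : Fin n}
    (h : QX F n q j * f = f * g) {v : Multiset (Fin n)}
    (hv : (monomialBasis hq).repr g v ≠ 0) : φ v ≤ φ {j} := by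
  set b := monomialBasis hq
  have hfs : (b.repr f).support.Nonempty := by
    simpa [Finsupp.support_nonempty_iff] using hf
  obtain ⟨u₀, hu₀, hmaxf⟩ := Finset.exists_max_image _ φ hfs
  obtain ⟨v₀, hv₀, hmaxg⟩ := Finset.exists_max_image (b.repr g).support φ
    ⟨v, Finsupp.mem_support_iff.2 hv⟩
  have htop : b.repr (f * g) (u₀ + v₀) ≠ 0 := by
    rw [repr_mul_of_unique hq]
    · exact mul_ne_zero (Finsupp.mem_support_iff.1 hu₀)
        (mul_ne_zero (Finsupp.mem_support_iff.1 hv₀) (repr_monomial_mul_ne_zero hq _ _))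
    · intro u' v' hu' hv' he
      have he' := congrArg φ he
      rw [map_add, map_add, add_eq_add_iff_eq_and_eq (hmaxf _ (Finsupp.mem_support_iff.2 hu'))
        (hmaxg _ (Finsupp.mem_support_iff.2 hv'))] at he'
      exact ⟨hφ he'.1, hφ he'.2⟩
  rw [← h] at htop
  obtain ⟨t, u, ht, hu, he⟩ := exists_of_repr_mul_ne_zero hq htop
  obtain rfl : {j} = t := by
    by_contra hne
    exact ht (by rw [repr_QX, Finsupp.single_apply, if_neg hne])
  have he' := congrArg φ he
  rw [map_add, map_add, add_comm (φ u₀)] at he'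
  have : φ v₀ ≤ φ {j} := by
    have hle : φ v₀ + φ u₀ ≤ φ {j} + φ u₀ :=
      he' ▸ add_le_add_right (hmaxf u (Finsupp.mem_support_iff.2 hu)) _
    exact le_of_add_le_add_right hle
  exact (hmaxg v (Finsupp.mem_support_iff.2 hv)).trans this

/-- The lexicographic order on exponents. -/
def lexHom (n : ℕ) : Multiset (Fin n) →+ Lex (Fin n → ℕ) where
  toFun m := toLex fun i => m.count i
  map_zero' := congrArg toLex (funext fun i => by simp)
  map_add' a b := congrArg toLex (funext fun i => by simp)

theorem lexHom_injective (n : ℕ) : Function.Injective (lexHom n) := fun _ _ h =>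
  Multiset.ext.2 fun i => congrFun (toLex.injective h) i

/-- The reversed lexicographic order on exponents. -/
def dualLexHom (n : ℕ) : Multiset (Fin n) →+ (Lex (Fin n → ℕ))ᵒᵈ where
  toFun m := OrderDual.toDual (lexHom n m)
  map_zero' := by simp
  map_add' _ _ := by simp

theorem eq_smul_QX_of_QX_mul_eq (hq : MultAntisym F q) {f g : QuantumAffineSpace F n q}
    (hf : f ≠ 0) {j : Fin n} (h : QX F n q j * f = f * g) : ∃ c : F, g = c • QX F n q j := by
  have hsupp : ∀ v, (monomialBasis hq).repr g v ≠ 0 → v = {j} := fun v hv =>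
    lexHom_injective n <| le_antisymm
      (support_le_of_QX_mul_eq (lexHom n) (lexHom_injective n) hq hf h hv)
      (support_le_of_QX_mul_eq (dualLexHom n) (lexHom_injective n) hq hf h hv)
  refine ⟨(monomialBasis hq).repr g {j}, (monomialBasis hq).repr.injective ?_⟩
  ext v
  rw [map_smul, repr_QX, Finsupp.smul_apply, Finsupp.single_apply]
  split_ifs with hv
  · simp [hv]
  · by_contra hne
    exact hv (hsupp v (by simpa using hne)).symm

/-- All monomials of an `X j`-normal element have the same commutation factor with `X j`. -/
theorem commutation_eq_of_QX_mul_eq (hq : MultAntisym F q) {f g : QuantumAffineSpace F n q}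
    (hf : f ≠ 0) {j : Fin n} (h : QX F n q j * f = f * g) :
    ∃ c : F, ∀ m, (monomialBasis hq).repr f m ≠ 0 → (m.map (q j)).prod = c := by
  obtain ⟨c, rfl⟩ := eq_smul_QX_of_QX_mul_eq hq hf h
  refine ⟨c, fun m hm => ?_⟩
  have hl := repr_mul_of_unique hq (f := QX F n q j) (g := f) (u := {j}) (v := m)
    fun u' v' hu' _ he => by
      obtain rfl : {j} = u' := by
        by_contra hne
        exact hu' (by rw [repr_QX, Finsupp.single_apply, if_neg hne])
      exact ⟨rfl, add_left_cancel he⟩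
  have hr := repr_mul_of_unique hq (f := f) (g := QX F n q j) (u := m) (v := {j})
    fun u' v' _ hv' he => by
      obtain rfl : {j} = v' := by
        by_contra hne
        exact hv' (by rw [repr_QX, Finsupp.single_apply, if_neg hne])
      exact ⟨add_right_cancel he, rfl⟩
  have hne := repr_monomial_mul_ne_zero hq m {j}
  rw [h, add_comm, mul_smul_comm, map_smul, Finsupp.smul_apply, hr, repr_QX, monomial_singleton,
    QX_mul_monomial hq, map_smul, Finsupp.smul_apply] at hl
  rw [monomial_singleton] at hne
  simp only [Finsupp.single_eq_same, smul_eq_mul, one_mul] at hl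
  have hl' : (c - (m.map (q j)).prod) * ((monomialBasis hq).repr f m *
      (monomialBasis hq).repr (monomial q m * QX F n q j) (m + {j})) = 0 := by
    linear_combination hl
  rcases mul_eq_zero.1 hl' with h0 | h0
  · exact (sub_eq_zero.1 h0).symm
  · exact absurd h0 (mul_ne_zero hm hne)

theorem QX_ne_zero (hq : MultAntisym F q) (i : Fin n) : QX F n q i ≠ 0 := by
  rw [← monomial_singleton, ← monomialBasis_apply hq]
  exact (monomialBasis hq).ne_zero _

theorem QX_mul_QX_ne_zero (hq : MultAntisym F q) (i j : Fin n) :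
    QX F n q i * QX F n q j ≠ 0 := fun h => by
  have := repr_monomial_mul_ne_zero hq {i} {j}
  rw [monomial_singleton, monomial_singleton, h] at this
  simp at this

/-- If exponents are determined by their commutation factors, automorphisms map generators to
multiples of monomials. -/
theorem exists_eq_smul_monomial (hq : MultAntisym F q)
    (hinj : ∀ m m' : Multiset (Fin n),
      (∀ j, (m.map (q j)).prod = (m'.map (q j)).prod) → m = m')
    (σ : QuantumAffineSpace F n q ≃ₐ[F] QuantumAffineSpace F n q) (i : Fin n) :
    ∃ (a : F) (m : Multiset (Fin n)), a ≠ 0 ∧ σ (QX F n q i) = a • monomial q m := by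
  set f := σ (QX F n q i)
  have hf : f ≠ 0 := by simpa [f] using QX_ne_zero hq i
  have hcomm : ∀ j, ∃ c : F, ∀ m, (monomialBasis hq).repr f m ≠ 0 → (m.map (q j)).prod = c := by
    intro j
    obtain ⟨y, hy⟩ := exists_mul_eq_QX_mul hq i (σ.symm (QX F n q j))
    refine commutation_eq_of_QX_mul_eq hq hf (g := σ y) ?_
    simpa using congrArg σ hy
  obtain ⟨m, hm⟩ : ∃ m, (monomialBasis hq).repr f m ≠ 0 := by
    by_contra! h0
    exact hf ((monomialBasis hq).repr.injective (by ext m; simp [h0]))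
  refine ⟨_, m, hm, (monomialBasis hq).repr.injective ?_⟩
  ext m'
  rw [map_smul, ← monomialBasis_apply hq, Module.Basis.repr_self, Finsupp.smul_apply,
    Finsupp.single_apply]
  split_ifs with he
  · simp [he]
  · by_contra hne
    refine he (hinj _ _ fun j => ?_)
    obtain ⟨c, hc⟩ := hcomm j
    rw [hc m hm, hc m' (by simpa using hne)]

theorem map_wordProd_eq_smul_monomial (hq : MultAntisym F q)
    (σ : QuantumAffineSpace F n q ≃ₐ[F] QuantumAffineSpace F n q)
    {a : Fin n → F} {m : Fin n → Multiset (Fin n)} (ha : ∀ i, a i ≠ 0)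
    (h : ∀ i, σ (QX F n q i) = a i • monomial q (m i)) (w : List (Fin n)) :
    ∃ c : F, c ≠ 0 ∧ σ (wordProd q w) = c • monomial q (w.map m).sum := by
  induction w with
  | nil => exact ⟨1, one_ne_zero, by simp [wordProd, monomial]⟩
  | cons i w ih =>
    obtain ⟨c, hc, hw⟩ := ih
    obtain ⟨d, hd, hm⟩ := monomial_mul hq (m i) (w.map m).sum
    refine ⟨a i * c * d, mul_ne_zero (mul_ne_zero (ha i) hc) hd, ?_⟩
    rw [wordProd_cons, map_mul, hw, h, smul_mul_smul_comm, hm, smul_smul]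
    simp

theorem eq_of_smul_monomial_eq (hq : MultAntisym F q) {c d : F} {u v : Multiset (Fin n)}
    (hc : c ≠ 0) (h : c • monomial q u = d • monomial q v) : u = v := by
  rw [← monomialBasis_apply hq, ← monomialBasis_apply hq] at h
  have := DFunLike.congr_fun (congrArg (monomialBasis hq).repr h) u
  by_contra hne
  simp [Ne.symm hne, hc] at this

/-- If exponents are determined by their commutation factors, every automorphism permutes the
generators up to scalars, and preserves the multiparameters. -/
theorem exists_perm (hq : MultAntisym F q)
    (hinj : ∀ m m' : Multiset (Fin n),
      (∀ j, (m.map (q j)).prod = (m'.map (q j)).prod) → m = m')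
    (σ : QuantumAffineSpace F n q ≃ₐ[F] QuantumAffineSpace F n q) :
    ∃ (a : Fin n → F) (π : Equiv.Perm (Fin n)), (∀ i, a i ≠ 0) ∧
      (∀ i, σ (QX F n q i) = a i • QX F n q (π i)) ∧ ∀ i j, q (π i) (π j) = q i j := by
  choose a m ha hm using exists_eq_smul_monomial hq hinj σ
  choose b l hb hl using exists_eq_smul_monomial hq hinj σ.symm
  have hex : ∀ j, ∃ k, m k = {j} := by
    intro j
    obtain ⟨c, hc, hw⟩ := map_wordProd_eq_smul_monomial hq σ ha hm (l j).toList
    have h₁ : (1 : F) • monomial q {j} = (b j * c) • monomial q ((l j).toList.map m).sum := by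
      rw [mul_smul, ← hw, ← map_smul, one_smul, monomial_singleton,
        ← σ.apply_symm_apply (QX F n q j), hl j]
      rfl
    have h₂ := eq_of_smul_monomial_eq hq one_ne_zero h₁
    have hj : j ∈ ((l j).toList.map m).sum := h₂ ▸ Multiset.mem_singleton_self j
    rw [← Multiset.sum_coe, ← Multiset.map_coe, Multiset.coe_toList] at h₂ hj
    obtain ⟨s, hs, hjs⟩ := Multiset.mem_join.1 hj
    obtain ⟨k, -, rfl⟩ := Multiset.mem_map.1 hs
    refine ⟨k, ((Multiset.le_singleton.1 ?_).resolve_left ?_)⟩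
    · rw [h₂]
      exact Multiset.single_le_sum (fun _ _ => Multiset.zero_le _) _ hs
    · rintro h0
      simp [h0] at hjs
  choose ρ hρ using hex
  have hρinj : Function.Injective ρ := fun i j h => by
    have := (hρ i).symm.trans ((congrArg m h).trans (hρ j))
    simpa using this
  let e := Equiv.ofBijective ρ (Finite.injective_iff_bijective.1 hρinj)
  have hσ : ∀ i, σ (QX F n q i) = a i • QX F n q (e.symm i) := fun i => by
    have h₁ := hρ (e.symm i)
    have h₂ : ρ (e.symm i) = i := e.apply_symm_apply i
    rw [h₂] at h₁
    rw [hm, h₁, monomial_singleton]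
  refine ⟨a, e.symm, ha, hσ, fun i j => ?_⟩
  have h := congrArg σ (QX_mul_QX hq i j)
  rw [map_smul, map_mul, map_mul, hσ, hσ, smul_mul_smul_comm, smul_mul_smul_comm,
    QX_mul_QX hq (e.symm i), smul_smul, smul_smul] at h
  have h' := smul_left_injective F (QX_mul_QX_ne_zero hq (e.symm j) (e.symm i)) h
  have hij := mul_ne_zero (ha i) (ha j)
  exact mul_left_cancel₀ hij (by linear_combination h')

section Rank

variable (u : Fin n → Fin n → Fˣ)

/-- The subgroup generated by the multiparameters not involving the index `a`. -/
def subLambda (a : Fin n) : Subgroup Fˣ :=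
  Subgroup.closure {x | ∃ i j, i < j ∧ i ≠ a ∧ j ≠ a ∧ x = u i j}

variable {u}

theorem mem_subLambda (hu : ∀ i, u i i = 1) (hu' : ∀ i j, u j i = (u i j)⁻¹) {a i j : Fin n}
    (hi : i ≠ a) (hj : j ≠ a) : u i j ∈ subLambda u a := by
  rcases lt_trichotomy i j with h | rfl | h
  · exact Subgroup.subset_closure ⟨i, j, h, hi, hj, rfl⟩
  · rw [hu]; exact one_mem _
  · rw [hu' j i]
    exact inv_mem (Subgroup.subset_closure ⟨j, i, h, hj, hi, rfl⟩)

theorem card_lt_pairs (a : Fin n) :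
    (Finset.univ.filter fun p : Fin n × Fin n => p.1 < p.2 ∧ p.1 ≠ a ∧ p.2 ≠ a).card
      ≤ (n - 1) * (n - 2) / 2 := by
  have h : (n - 1) * (n - 2) / 2 = ((Finset.univ.erase a).powersetCard 2).card := by
    rw [Finset.card_powersetCard, Finset.card_erase_of_mem (Finset.mem_univ _), Finset.card_univ,
      Fintype.card_fin, Nat.choose_two_right, Nat.sub_sub]
  rw [h]
  refine Finset.card_le_card_of_injOn (fun p => {p.1, p.2}) ?_ ?_
  · rintro ⟨i, j⟩ hp
    simp only [Finset.coe_filter, Finset.mem_univ, true_and, Set.mem_ofPred_eq] at hp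
    simp only [Finset.mem_coe, Finset.mem_powersetCard]
    refine ⟨?_, Finset.card_pair hp.1.ne⟩
    intro x hx
    simp only [Finset.mem_insert, Finset.mem_singleton] at hx
    rcases hx with rfl | rfl <;> simp [hp.2]
  · rintro ⟨i, j⟩ hp ⟨i', j'⟩ hp' he
    simp only [Finset.coe_filter, Finset.mem_univ, true_and, Set.mem_ofPred_eq] at hp hp'
    replace he : ({i, j} : Finset (Fin n)) = {i', j'} := he
    have h₁ : i ∈ ({i', j'} : Finset (Fin n)) := he ▸ by simp
    have h₂ : j ∈ ({i', j'} : Finset (Fin n)) := he ▸ by simp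
    simp only [Finset.mem_insert, Finset.mem_singleton] at h₁ h₂
    rcases h₁ with rfl | rfl <;> rcases h₂ with rfl | rfl
    · exact absurd hp.1 (lt_irrefl _)
    · rfl
    · exact absurd hp.1 hp'.1.asymm
    · exact absurd hp.1 (lt_irrefl _)

/-- A group of large rank is not, up to bounded powers, generated by the multiparameters not
involving some index. -/
theorem not_zpow_mem_subLambda (hu : ∀ i, u i i = 1) (hu' : ∀ i j, u j i = (u i j)⁻¹)
    {g : Fin ((n - 1) * (n - 2) / 2 + 1) → Fˣ}
    (hg : ∀ s, g s ∈ Subgroup.closure {x | ∃ i j : Fin n, i < j ∧ x = u i j})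
    (hind : ∀ a : Fin ((n - 1) * (n - 2) / 2 + 1) → ℤ, (∏ s, g s ^ a s) = 1 → a = 0)
    (a : Fin n) {N : ℤ} (hN : N ≠ 0) (h : ∀ j, j ≠ a → u a j ^ N ∈ subLambda u a) : False := by
  classical
  have hpow : ∀ s, g s ^ N ∈ subLambda u a := by
    intro s
    have hle : Subgroup.closure {x | ∃ i j : Fin n, i < j ∧ x = u i j} ≤
        (subLambda u a).comap (zpowGroupHom N) := by
      rw [Subgroup.closure_le]
      rintro _ ⟨i, j, hij, rfl⟩
      simp only [Subgroup.coe_comap, Set.mem_preimage, zpowGroupHom_apply, SetLike.mem_coe]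
      by_cases hi : i = a
      · subst hi
        exact h j hij.ne'
      by_cases hj : j = a
      · subst hj
        rw [hu' j i, inv_zpow]
        exact inv_mem (h i hi)
      exact zpow_mem (mem_subLambda hu hu' hi hj) N
    exact hle (hg s)
  have hli : LinearIndependent ℤ fun s => Additive.ofMul (g s ^ N) := by
    rw [Fintype.linearIndependent_iff]
    intro c hc s
    have := hind (fun s => N * c s) (by
      have hc' := congrArg Additive.toMul hc
      simpa [toMul_sum, zpow_mul] using hc')
    simpa [hN] using congrFun this s
  set P := Finset.univ.filter fun p : Fin n × Fin n => p.1 < p.2 ∧ p.1 ≠ a ∧ p.2 ≠ a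
  set W : Finset (Additive Fˣ) := P.image fun p => Additive.ofMul (u p.1 p.2)
  have hspan : Set.range (fun s => Additive.ofMul (g s ^ N)) ≤
      (Submodule.span ℤ (W : Set (Additive Fˣ)) : Set (Additive Fˣ)) := by
    rintro _ ⟨s, rfl⟩
    refine Subgroup.closure_induction (p := fun x _ => Additive.ofMul x ∈ Submodule.span ℤ
      (W : Set (Additive Fˣ))) ?_ (zero_mem _) (fun _ _ _ _ => add_mem) (fun _ _ => neg_mem)
      (hpow s)
    rintro _ ⟨i, j, hij, hi, hj, rfl⟩
    refine Submodule.subset_span ?_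
    rw [Finset.mem_coe, Finset.mem_image]
    exact ⟨(i, j), by simp [P, hij, hi, hj], rfl⟩
  have hcard := linearIndependent_le_span' _ hli (W : Set (Additive Fˣ)) hspan
  have hW : W.card ≤ (n - 1) * (n - 2) / 2 := Finset.card_image_le.trans (card_lt_pairs a)
  simp at hcard
  omega

end Rank

end QuantumAffine

open QuantumAffine in
theorem triviality_of_aut_large_lambda_group (F : Type*) [Field F]
    (n : ℕ) (hn : 3 ≤ n) (q : Fin n → Fin n → F) (hq : MultAntisym F q)
    (htf : ∀ u ∈ lambdaGroup F q, ∀ k : ℕ, 0 < k → u ^ k = 1 → u = 1)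
    (hrank : ∃ g : Fin ((n - 1) * (n - 2) / 2 + 1) → Fˣ,
        (∀ s, g s ∈ lambdaGroup F q) ∧
        ∀ a : Fin ((n - 1) * (n - 2) / 2 + 1) → ℤ, (∏ s, g s ^ a s) = 1 → a = 0) :
    ∀ σ : QuantumAffineSpace F n q ≃ₐ[F] QuantumAffineSpace F n q, IsScalarAut F n q σ := by
  obtain ⟨g, hg, hind⟩ := hrank
  set u : Fin n → Fin n → Fˣ := fun i j => Units.mk0 (q i j) (hq.1 i j)
  have hu : ∀ i, u i i = 1 := fun i => Units.ext (hq.2.1 i)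
  have hu' : ∀ i j, u j i = (u i j)⁻¹ := fun i j => Units.ext (by simp [u, hq.2.2 i j])
  have hg' : ∀ s, g s ∈ Subgroup.closure {x | ∃ i j : Fin n, i < j ∧ x = u i j} := by
    simpa [lambdaGroup, Units.ext_iff, u] using hg
  have hrank := fun a N => not_zpow_mem_subLambda hu hu' hg' hind a (N := N)
  have hinj : ∀ m m' : Multiset (Fin n),
      (∀ j, (m.map (q j)).prod = (m'.map (q j)).prod) → m = m' := by
    intro m m' h
    by_contra hne
    obtain ⟨a, ha⟩ : ∃ a, m.count a ≠ m'.count a := by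
      by_contra! h0
      exact hne (Multiset.ext.2 h0)
    refine hrank a (m.count a - m'.count a : ℤ) (by omega) fun j hj => ?_
    have hprod : ∏ k, u j k ^ (m.count k - m'.count k : ℤ) = 1 := by
      have key : ∀ s : Multiset (Fin n), (s.map (u j)).prod = ∏ k, u j k ^ (s.count k) :=
        fun s => Finset.prod_multiset_map_count s (u j) |>.trans
          (Finset.prod_subset (Finset.subset_univ _) fun k _ hk => by
            simp [Multiset.count_eq_zero.2 fun h => hk (Multiset.mem_toFinset.2 h)])
      have hmap : ∀ s : Multiset (Fin n), ((s.map (u j)).prod : F) = (s.map (q j)).prod :=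
        fun s => by
          rw [← Units.coeHom_apply, map_multiset_prod, Multiset.map_map]
          rfl
      have heq : (m.map (u j)).prod = (m'.map (u j)).prod :=
        Units.ext (by rw [hmap, hmap, h j])
      simp only [zpow_sub, zpow_natCast, Finset.prod_mul_distrib, Finset.prod_inv_distrib]
      rw [← key, ← key, heq, mul_inv_cancel]
    rw [← Finset.mul_prod_erase _ _ (Finset.mem_univ a)] at hprod
    rw [hu' j a, inv_zpow, inv_eq_of_mul_eq_one_right hprod]
    exact prod_mem fun k hk =>
      zpow_mem (mem_subLambda hu hu' hj (Finset.ne_of_mem_erase hk)) _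
  intro σ
  obtain ⟨a, π, ha, hσ, hπ⟩ := exists_perm hq hinj σ
  have hπu : ∀ i j, u (π i) (π j) = u i j := fun i j => Units.ext (hπ i j)
  refine ⟨a, ha, fun i => ?_⟩
  suffices π i = i by rw [hσ, this]
  by_contra hi
  refine hrank i 2 two_ne_zero fun j hj => ?_
  have hmem : ∀ k, π k ≠ i → u i k ∈ subLambda u i := fun k hk => by
    rw [← hπu]
    exact mem_subLambda hu hu' hi hk
  by_cases hji : π j = i
  · have h₁ : u i j = u (π i) i := by rw [← hπu, hji]
    by_cases hππ : π (π i) = i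
    · have h₂ : π i = j := π.injective (hππ.trans hji.symm)
      have h₃ : u i j ^ (2 : ℤ) = 1 := by
        rw [zpow_two]
        nth_rewrite 1 [h₁]
        rw [h₂, hu' i j, inv_mul_cancel]
      rw [h₃]
      exact one_mem _
    · rw [h₁, hu' i]
      exact zpow_mem (inv_mem (hmem _ hππ)) _
  · exact zpow_mem (hmem j hji) _
end

section
/- Let 𝔽 be a field, let n ≥ 2, and let 𝔮 = (q_{ij}) be a multiplicatively antisymmetric n×n matrix over 𝔽. Suppose that whenever γ,γ' ∈ ℤ^n satisfy λ(γ,γ') = 1 (where λ is the alternating bicharacter associated with 𝔮), the vectors γ and γ' are ℤ-linearly dependent (this says exactly that the quantum torus associated with 𝔮 has dimension one). Then every 𝔽-algebra automorphism of the quantum affine space 𝒪_𝔮 is scalar. -/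
/-- The alternating bicharacter associated with the matrix `q`:
`λ(γ,γ') = ∏_{i<j} q i j ^ (γ i * γ' j - γ j * γ' i)`. -/
def bicharOfMatrix {F : Type*} [Field F] {n : ℕ} (q : Fin n → Fin n → F)
    (γ γ' : Fin n → ℤ) : F :=
  ∏ i : Fin n, ∏ j : Fin n,
    if i < j then q i j ^ (γ i * γ' j - γ j * γ' i) else 1

section TwistedBasis

variable {F A Γ : Type*} [Field F] [Ring A] [Algebra F A] [AddCommMonoid Γ]

/-- The coefficient of a product at a uniquely attained sum of exponents does not vanish. -/
theorem repr_mul_ne_zero_of_uniqueAdd (b : Module.Basis Γ F A) (c : Γ → Γ → F)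
    (hc : ∀ γ δ, c γ δ ≠ 0) (hb : ∀ γ δ, b γ * b δ = c γ δ • b (γ + δ)) (y u : A) {α β : Γ}
    (hα : α ∈ (b.repr y).support) (hβ : β ∈ (b.repr u).support)
    (h : UniqueAdd (b.repr y).support (b.repr u).support α β) :
    b.repr (y * u) (α + β) ≠ 0 := by
  classical
  have key : b.repr (y * u) (α + β) = b.repr y α * b.repr u β * c α β := by
    conv_lhs => rw [← b.linearCombination_repr y, ← b.linearCombination_repr u]
    simp only [Finsupp.linearCombination_apply, Finsupp.sum, Finset.sum_mul, Finset.mul_sum,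
      smul_mul_smul_comm, hb, map_sum, map_smul, b.repr_self, Finsupp.coe_finsetSum,
      Finset.sum_apply, Finsupp.smul_apply, smul_eq_mul]
    rw [Finset.sum_comm, Finset.sum_eq_single α, Finset.sum_eq_single β]
    · simp [mul_assoc]
    · intro δ hδ hne
      rw [Finsupp.single_eq_of_ne]
      · simp
      · intro he
        exact hne (h hα hδ he.symm).2
    · intro h'
      exact absurd hβ h'
    · intro γ hγ hne
      refine Finset.sum_eq_zero fun δ hδ => ?_
      rw [Finsupp.single_eq_of_ne]
      · simp
      · intro he
        exact hne (h hγ hδ he.symm).1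
    · intro h'
      exact absurd hα h'
  rw [key]
  exact mul_ne_zero (mul_ne_zero (Finsupp.mem_support_iff.1 hα) (Finsupp.mem_support_iff.1 hβ))
    (hc _ _)

theorem exists_repr_ne_zero_of_repr_mul_basis_ne_zero (b : Module.Basis Γ F A) (c : Γ → Γ → F)
    (hb : ∀ γ δ, b γ * b δ = c γ δ • b (γ + δ)) (u : A) (ε η : Γ)
    (h : b.repr (u * b ε) η ≠ 0) : ∃ γ ∈ (b.repr u).support, η = γ + ε := by
  classical
  rw [← b.linearCombination_repr u] at h
  simp only [Finsupp.linearCombination_apply, Finsupp.sum, Finset.sum_mul,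
    smul_mul_assoc, hb, map_sum, map_smul, b.repr_self, Finsupp.coe_finsetSum,
    Finset.sum_apply, Finsupp.smul_apply, smul_eq_mul] at h
  obtain ⟨γ, hγ, hne⟩ := Finset.exists_ne_zero_of_sum_ne_zero h
  refine ⟨γ, hγ, ?_⟩
  by_contra he
  rw [Finsupp.single_eq_of_ne he] at hne
  simp at hne

/-- If `y * u = u * b ε` with `u ≠ 0`, then `y` is a multiple of `b ε`. -/
theorem eq_of_mem_support_of_mul_eq_mul_basis [LinearOrder Γ] [IsOrderedCancelAddMonoid Γ]
    (b : Module.Basis Γ F A) (c : Γ → Γ → F)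
    (hc : ∀ γ δ, c γ δ ≠ 0) (hb : ∀ γ δ, b γ * b δ = c γ δ • b (γ + δ)) (y u : A) (ε : Γ)
    (hu : u ≠ 0) (h : y * u = u * b ε) : ∀ γ ∈ (b.repr y).support, γ = ε := by
  intro γ hγ
  have hy : (b.repr y).support.Nonempty := ⟨γ, hγ⟩
  have hu' : (b.repr u).support.Nonempty := by
    rw [Finsupp.support_nonempty_iff]
    simpa using hu
  apply le_antisymm
  · have hne := repr_mul_ne_zero_of_uniqueAdd b c hc hb y u (Finset.max'_mem _ hy)
      (Finset.max'_mem _ hu') (by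
        intro γ' δ' hγ' hδ' he
        exact (add_eq_add_iff_eq_and_eq (Finset.le_max' _ _ hγ') (Finset.le_max' _ _ hδ')).1 he)
    rw [h] at hne
    obtain ⟨γ', hγ', he⟩ := exists_repr_ne_zero_of_repr_mul_basis_ne_zero b c hb u ε _ hne
    have h1 := Finset.le_max' _ _ hγ'
    have h2 := Finset.le_max' _ _ hγ
    refine h2.trans (le_of_add_le_add_right (a := (b.repr u).support.max' hu') ?_)
    rw [he, add_comm]
    gcongr
  · have hne := repr_mul_ne_zero_of_uniqueAdd b c hc hb y u (Finset.min'_mem _ hy)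
      (Finset.min'_mem _ hu') (by
        intro γ' δ' hγ' hδ' he
        have := (add_eq_add_iff_eq_and_eq (Finset.min'_le _ _ hγ') (Finset.min'_le _ _ hδ')).1
          he.symm
        exact ⟨this.1.symm, this.2.symm⟩)
    rw [h] at hne
    obtain ⟨γ', hγ', he⟩ := exists_repr_ne_zero_of_repr_mul_basis_ne_zero b c hb u ε _ hne
    have h1 := Finset.min'_le _ _ hγ'
    have h2 := Finset.min'_le _ _ hγ
    refine le_trans (le_of_add_le_add_right (a := (b.repr u).support.min' hu') ?_) h2
    rw [he, add_comm]
    gcongr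

end TwistedBasis

section Bicharacter

variable {F : Type*} [Field F] {n : ℕ} {q : Fin n → Fin n → F}

theorem bicharOfMatrix_eq_prod (hq : MultAntisym F q) (γ γ' : Fin n → ℤ) :
    bicharOfMatrix q γ γ' = ∏ i, ∏ j, q i j ^ (γ i * γ' j) := by
  obtain ⟨h0, h1, h2⟩ := hq
  have hsplit : ∀ i j, q i j ^ (γ i * γ' j) = (if i < j then q i j ^ (γ i * γ' j) else 1) *
      (if j < i then q i j ^ (γ i * γ' j) else 1) := by
    intro i j
    rcases lt_trichotomy i j with h | rfl | h
    · rw [if_pos h, if_neg h.not_gt, mul_one]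
    · simp [h1]
    · rw [if_pos h, if_neg h.not_gt, one_mul]
  rw [Finset.prod_congr rfl fun i _ => Finset.prod_congr rfl fun j _ => hsplit i j]
  simp_rw [Finset.prod_mul_distrib]
  rw [Finset.prod_comm (f := fun i j => if j < i then q i j ^ (γ i * γ' j) else 1)]
  simp_rw [← Finset.prod_mul_distrib, bicharOfMatrix]
  refine Finset.prod_congr rfl fun i _ => Finset.prod_congr rfl fun j _ => ?_
  split_ifs
  · rw [h2 i j, inv_zpow', ← zpow_add₀ (h0 i j), sub_eq_add_neg]
  · simp

theorem bicharOfMatrix_single (hq : MultAntisym F q) (γ : Fin n → ℤ) (j : Fin n) :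
    bicharOfMatrix q γ (Pi.single j 1) = ∏ k, q k j ^ γ k := by
  rw [bicharOfMatrix_eq_prod hq]
  refine Finset.prod_congr rfl fun i _ => ?_
  rw [Finset.prod_eq_single j] <;> simp +contextual

/-- In dimension one, an exponent vector is determined by its commutation scalars. -/
theorem eq_of_prod_pow_eq (hn : 2 ≤ n) (hq : MultAntisym F q)
    (hdim : ∀ γ γ' : Fin n → ℤ, bicharOfMatrix q γ γ' = 1 → ¬ LinearIndependent ℤ ![γ, γ'])
    {γ δ : Fin n → ℕ} (h : ∀ j, ∏ k, q k j ^ γ k = ∏ k, q k j ^ δ k) : γ = δ := by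
  by_contra hne
  obtain ⟨i, hi⟩ := Function.ne_iff.1 hne
  have : Nontrivial (Fin n) := Fin.nontrivial_iff_two_le.2 hn
  obtain ⟨j, hj⟩ := exists_ne i
  refine hdim (fun k => (γ k : ℤ) - δ k) (Pi.single j 1) ?_ ?_
  · rw [bicharOfMatrix_single hq]
    simp_rw [zpow_sub₀ (hq.1 _ _), zpow_natCast]
    rw [Finset.prod_div_distrib, h j, div_self]
    exact Finset.prod_ne_zero_iff.2 fun k _ => pow_ne_zero _ (hq.1 _ _)
  · rw [LinearIndependent.pair_iff]
    intro s t hst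
    have hs : s = 0 := by
      have := congrFun hst i
      simp [hj.symm] at this
      omega
    refine ⟨hs, ?_⟩
    have := congrFun hst j
    simpa [hs] using this

/-- In dimension one, an index permutation preserving the parameters is trivial. -/
theorem apply_eq_self_of_forall_apply_eq (hq : MultAntisym F q)
    (hdim : ∀ γ γ' : Fin n → ℤ, bicharOfMatrix q γ γ' = 1 → ¬ LinearIndependent ℤ ![γ, γ'])
    {f : Fin n → Fin n} (hf : Function.Bijective f) (h : ∀ i j, q (f i) (f j) = q i j)
    (i : Fin n) : f i = i := by
  by_contra hne
  refine hdim (fun _ => 1) (fun k => (Pi.single (f i) 1 : Fin n → ℤ) k -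
    (Pi.single i 1 : Fin n → ℤ) k) ?_ ?_
  · have key : ∀ j, ∏ k, ∏ l, q k l ^ ((Pi.single j 1 : Fin n → ℤ) l) = ∏ k, q k j := by
      intro j
      refine Finset.prod_congr rfl fun k _ => ?_
      rw [Finset.prod_eq_single j] <;> simp +contextual
    rw [bicharOfMatrix_eq_prod hq]
    simp_rw [one_mul, zpow_sub₀ (hq.1 _ _), Finset.prod_div_distrib, key]
    rw [← hf.prod_comp (fun k => q k (f i))]
    simp_rw [h]
    exact div_self (Finset.prod_ne_zero_iff.2 fun k _ => hq.1 _ _)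
  · rw [LinearIndependent.pair_iff]
    intro s t hst
    have h1 := congrFun hst (f i)
    have h2 := congrFun hst i
    simp [hne, Ne.symm hne] at h1 h2
    omega

end Bicharacter

section QuantumAffineSpace

variable {F : Type*} [Field F] {n : ℕ} {q : Fin n → Fin n → F}

theorem QX_mul_QX (hq : MultAntisym F q) (i j : Fin n) :
    QX F n q i * QX F n q j = q i j • (QX F n q j * QX F n q i) := by
  have key : ∀ i j : Fin n, i < j →
      QX F n q i * QX F n q j = q i j • (QX F n q j * QX F n q i) := by
    intro i j h
    have := RingQuot.mkAlgHom_rel F (QuantumRel.rel (F := F) (q := q) i j h)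
    simpa [QX] using this
  rcases lt_trichotomy i j with h | h | h
  · exact key i j h
  · simp [h, hq.2.1]
  · rw [key j i h, smul_smul, hq.2.2 i j, mul_inv_cancel₀ (hq.1 i j), one_smul]

theorem QX_mul_pow (hq : MultAntisym F q) (i j : Fin n) (k : ℕ) :
    QX F n q i * QX F n q j ^ k = q i j ^ k • (QX F n q j ^ k * QX F n q i) := by
  induction k with
  | zero => simp
  | succ k ih =>
    rw [pow_succ, ← mul_assoc, ih, smul_mul_assoc, mul_assoc, QX_mul_QX hq, mul_smul_comm,
      smul_smul, ← pow_succ, ← mul_assoc]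

theorem pow_mul_QX (hq : MultAntisym F q) (i j : Fin n) (k : ℕ) :
    QX F n q i ^ k * QX F n q j = q i j ^ k • (QX F n q j * QX F n q i ^ k) := by
  rw [QX_mul_pow hq, smul_smul, ← mul_pow, hq.2.2 i j, mul_inv_cancel₀ (hq.1 i j), one_pow,
    one_smul]

/-- The ordered monomial with exponent vector `γ`. -/
noncomputable def QMonomial (q : Fin n → Fin n → F) (γ : Fin n → ℕ) : QuantumAffineSpace F n q :=
  ((List.finRange n).map fun i => QX F n q i ^ γ i).prod

theorem QMonomial_zero : QMonomial q 0 = 1 := by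
  simp [QMonomial]

theorem QMonomial_mul_QX (hq : MultAntisym F q) (γ : Fin n → ℕ) (j : Fin n) :
    QMonomial q γ * QX F n q j = (∏ k, q k j ^ γ k) • (QX F n q j * QMonomial q γ) := by
  have key : ∀ l : List (Fin n), (l.map fun i => QX F n q i ^ γ i).prod * QX F n q j =
      (l.map fun k => q k j ^ γ k).prod •
        (QX F n q j * (l.map fun i => QX F n q i ^ γ i).prod) := by
    intro l
    induction l with
    | nil => simp
    | cons a l ih =>
      simp only [List.map_cons, List.prod_cons]
      rw [mul_assoc, ih, mul_smul_comm, ← mul_assoc, pow_mul_QX hq, smul_mul_assoc, smul_smul,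
        mul_assoc, mul_comm (List.prod _)]
  rw [Fin.prod_univ_def]
  exact key _

theorem QX_mul_QMonomial (hq : MultAntisym F q) (i : Fin n) (γ : Fin n → ℕ) :
    ∃ c : F, c ≠ 0 ∧ QX F n q i * QMonomial q γ = c • QMonomial q (Pi.single i 1 + γ) := by
  have key : ∀ l : List (Fin n), l.Nodup → i ∈ l → ∃ c : F, c ≠ 0 ∧
      QX F n q i * (l.map fun k => QX F n q k ^ γ k).prod =
        c • (l.map fun k => QX F n q k ^ ((Pi.single i 1 + γ : Fin n → ℕ) k)).prod := by
    intro l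
    induction l with
    | nil => simp
    | cons a l ih =>
      intro hl hi
      rw [List.nodup_cons] at hl
      simp only [List.map_cons, List.prod_cons]
      by_cases ha : a = i
      · subst ha
        refine ⟨1, one_ne_zero, ?_⟩
        have : (l.map fun k => QX F n q k ^ ((Pi.single a 1 + γ : Fin n → ℕ) k)) =
            l.map fun k => QX F n q k ^ γ k := by
          refine List.map_congr_left fun k hk => ?_
          have hne : k ≠ a := fun h => hl.1 (h ▸ hk)
          simp [hne]
        rw [this, one_smul, ← mul_assoc, Pi.add_apply, Pi.single_eq_same, pow_add, pow_one]
      · obtain ⟨c, hc, h⟩ := ih hl.2 ((List.mem_cons.1 hi).resolve_left (Ne.symm ha))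
        refine ⟨q i a ^ γ a * c, mul_ne_zero (pow_ne_zero _ (hq.1 _ _)) hc, ?_⟩
        rw [← mul_assoc, QX_mul_pow hq, smul_mul_assoc, mul_assoc, h, mul_smul_comm, smul_smul]
        simp [ha]
  exact key _ (List.nodup_finRange n) (List.mem_finRange i)

theorem QMonomial_single (i : Fin n) : QMonomial q (Pi.single i 1) = QX F n q i := by
  have key : ∀ l : List (Fin n), l.Nodup →
      (l.map fun k => QX F n q k ^ ((Pi.single i 1 : Fin n → ℕ) k)).prod =
        if i ∈ l then QX F n q i else 1 := by
    intro l
    induction l with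
    | nil => simp
    | cons a l ih =>
      intro hl
      rw [List.nodup_cons] at hl
      simp only [List.map_cons, List.prod_cons, ih hl.2]
      by_cases ha : a = i
      · subst ha
        simp [hl.1]
      · simp [ha, Ne.symm ha]
  rw [QMonomial, key _ (List.nodup_finRange n), if_pos (List.mem_finRange i)]

/-- The ordered monomials span the quantum affine space. -/
theorem span_range_QMonomial (hq : MultAntisym F q) :
    Submodule.span F (Set.range (QMonomial q)) = ⊤ := by
  set S := Submodule.span F (Set.range (QMonomial q))
  have hX : ∀ i, ∀ x ∈ S, QX F n q i * x ∈ S := by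
    intro i x hx
    induction hx using Submodule.span_induction with
    | mem x hx =>
      obtain ⟨γ, rfl⟩ := hx
      obtain ⟨c, -, h⟩ := QX_mul_QMonomial hq i γ
      rw [h]
      exact S.smul_mem _ (Submodule.subset_span ⟨_, rfl⟩)
    | zero => simp
    | add x y _ _ hx hy => rw [mul_add]; exact S.add_mem hx hy
    | smul c x _ hx => rw [mul_smul_comm]; exact S.smul_mem _ hx
  have hall : ∀ a : FreeAlgebra F (Fin n), ∀ x ∈ S,
      RingQuot.mkAlgHom F (QuantumRel F n q) a * x ∈ S := by
    intro a
    induction a using FreeAlgebra.induction with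
    | grade0 r =>
      intro x hx
      rw [AlgHom.commutes, ← Algebra.smul_def]
      exact S.smul_mem _ hx
    | grade1 i => exact hX i
    | mul a b ha hb =>
      intro x hx
      rw [map_mul, mul_assoc]
      exact ha _ (hb _ hx)
    | add a b ha hb =>
      intro x hx
      rw [map_add, add_mul]
      exact S.add_mem (ha _ hx) (hb _ hx)
  rw [eq_top_iff]
  rintro x -
  obtain ⟨a, rfl⟩ := RingQuot.mkAlgHom_surjective F (QuantumRel F n q) x
  have := hall a 1 (Submodule.subset_span ⟨0, QMonomial_zero⟩)
  rwa [mul_one] at this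

/-- The operator by which `X i` acts on the space with basis the exponent vectors. -/
noncomputable def QOperator (q : Fin n → Fin n → F) (i : Fin n) :
    Module.End F ((Fin n → ℕ) →₀ F) :=
  Finsupp.linearCombination F fun γ : Fin n → ℕ =>
    Finsupp.single (Pi.single i 1 + γ) (∏ j, if j < i then q i j ^ γ j else 1)

theorem QOperator_single (i : Fin n) (γ : Fin n → ℕ) (r : F) :
    QOperator q i (Finsupp.single γ r) =
      Finsupp.single (Pi.single i 1 + γ) (r * ∏ j, if j < i then q i j ^ γ j else 1) := by
  simp [QOperator]

/-- The representation of the quantum affine space by the operators `QOperator q i`. -/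
theorem exists_representation (hq : MultAntisym F q) :
    ∃ ρ : QuantumAffineSpace F n q →ₐ[F] Module.End F ((Fin n → ℕ) →₀ F),
      ∀ i, ρ (QX F n q i) = QOperator q i := by
  have hshift : ∀ (i k : Fin n) (γ : Fin n → ℕ),
      (∏ j, if j < i then q i j ^ ((Pi.single k 1 + γ : Fin n → ℕ) j) else 1) =
        (if k < i then q i k else 1) * ∏ j, if j < i then q i j ^ γ j else 1 := by
    intro i k γ
    have : (if k < i then q i k else 1) = ∏ j, if j = k then (if j < i then q i j else 1) else 1 := by
      simp
    rw [this, ← Finset.prod_mul_distrib]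
    refine Finset.prod_congr rfl fun j _ => ?_
    by_cases hj : j = k
    · subst hj
      by_cases hji : j < i <;> simp [hji, pow_add]
    · simp [hj]
  refine ⟨RingQuot.liftAlgHom F ⟨FreeAlgebra.lift F (QOperator q), ?_⟩, ?_⟩
  · rintro _ _ ⟨i, j, hij⟩
    simp only [map_mul, map_smul, FreeAlgebra.lift_ι_apply]
    refine Finsupp.lhom_ext fun γ r => ?_
    simp only [Module.End.mul_apply, LinearMap.smul_apply, QOperator_single, hshift, hij,
      hij.not_gt, if_true, if_false, Finsupp.smul_single, smul_eq_mul]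
    congr 1
    · abel
    · rw [hq.2.2 i j]
      field_simp [hq.1 i j]
  · intro i
    simp [QX]

theorem linearIndependent_QMonomial (hq : MultAntisym F q) :
    LinearIndependent F (QMonomial q) := by
  obtain ⟨ρ, hρ⟩ := exists_representation hq
  have hX : ∀ (i : Fin n) (k : ℕ) (γ : Fin n → ℕ) (r : F), r ≠ 0 → ∃ s : F, s ≠ 0 ∧
      ρ (QX F n q i ^ k) (Finsupp.single γ r) = Finsupp.single (Pi.single i k + γ) s := by
    intro i k
    induction k with
    | zero => intro γ r hr; exact ⟨r, hr, by simp⟩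
    | succ k ih =>
      intro γ r hr
      obtain ⟨s, hs, h⟩ := ih γ r hr
      have hne : (∏ j, if j < i then q i j ^ ((Pi.single i k + γ : Fin n → ℕ) j) else 1) ≠ 0 := by
        refine Finset.prod_ne_zero_iff.2 fun j _ => ?_
        split_ifs
        · exact pow_ne_zero _ (hq.1 _ _)
        · exact one_ne_zero
      refine ⟨_, mul_ne_zero hs hne, ?_⟩
      rw [pow_succ', map_mul, Module.End.mul_apply, h, hρ, QOperator_single, ← add_assoc,
        ← Pi.single_add, add_comm 1 k]
  have hM : ∀ γ, ∃ s : F, s ≠ 0 ∧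
      ρ (QMonomial q γ) (Finsupp.single 0 1) = Finsupp.single γ s := by
    intro γ
    have key : ∀ l : List (Fin n), ∃ s : F, s ≠ 0 ∧
        ρ ((l.map fun i => QX F n q i ^ γ i).prod) (Finsupp.single 0 1) =
          Finsupp.single ((l.map fun i => (Pi.single i (γ i) : Fin n → ℕ)).sum) s := by
      intro l
      induction l with
      | nil => exact ⟨1, one_ne_zero, by simp⟩
      | cons a l ih =>
        obtain ⟨s, hs, h⟩ := ih
        obtain ⟨t, ht, h'⟩ := hX a (γ a) (l.map fun i => (Pi.single i (γ i) : Fin n → ℕ)).sum s hs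
        exact ⟨t, ht, by simp [-map_pow, h, h']⟩
    obtain ⟨s, hs, h⟩ := key (List.finRange n)
    refine ⟨s, hs, ?_⟩
    rw [QMonomial, h, ← Fin.sum_univ_def, Finset.univ_sum_single]
  choose s hs hM using hM
  let φ : QuantumAffineSpace F n q →ₗ[F] ((Fin n → ℕ) →₀ F) :=
    LinearMap.applyₗ (Finsupp.single 0 1) ∘ₗ ρ.toLinearMap
  refine LinearIndependent.of_comp φ ?_
  have hφ : (φ ∘ QMonomial q) = fun γ => (Units.mk0 (s γ) (hs γ)) • Finsupp.single γ (1 : F) := by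
    funext γ
    have : φ (QMonomial q γ) = ρ (QMonomial q γ) (Finsupp.single 0 1) := rfl
    simp [this, hM, Units.smul_def]
  rw [hφ]
  exact (Finsupp.linearIndependent_single_one F (Fin n → ℕ)).units_smul _

/-- The basis of ordered monomials. -/
noncomputable def QBasis (hq : MultAntisym F q) :
    Module.Basis (Fin n → ℕ) F (QuantumAffineSpace F n q) :=
  Module.Basis.mk (linearIndependent_QMonomial hq) (span_range_QMonomial hq).ge

theorem QBasis_apply (hq : MultAntisym F q) (γ : Fin n → ℕ) : QBasis hq γ = QMonomial q γ := by
  simp [QBasis]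

/-- `x` is a nonzero scalar multiple of the ordered monomial with exponent vector `γ`. -/
def IsScaledMonomial (q : Fin n → Fin n → F) (x : QuantumAffineSpace F n q) (γ : Fin n → ℕ) :
    Prop :=
  ∃ c : F, c ≠ 0 ∧ x = c • QMonomial q γ

theorem IsScaledMonomial.one : IsScaledMonomial q 1 0 :=
  ⟨1, one_ne_zero, by rw [one_smul, QMonomial_zero]⟩

theorem IsScaledMonomial.QX_pow_mul (hq : MultAntisym F q) {x : QuantumAffineSpace F n q}
    {γ : Fin n → ℕ} (hx : IsScaledMonomial q x γ) (i : Fin n) (k : ℕ) :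
    IsScaledMonomial q (QX F n q i ^ k * x) (Pi.single i k + γ) := by
  induction k with
  | zero => simpa using hx
  | succ k ih =>
    obtain ⟨c, hc, h⟩ := ih
    obtain ⟨d, hd, h'⟩ := QX_mul_QMonomial hq i (Pi.single i k + γ)
    refine ⟨c * d, mul_ne_zero hc hd, ?_⟩
    rw [pow_succ', mul_assoc, h, mul_smul_comm, h', smul_smul, ← add_assoc, ← Pi.single_add,
      add_comm 1 k]

theorem IsScaledMonomial.mul (hq : MultAntisym F q) {x y : QuantumAffineSpace F n q}
    {γ δ : Fin n → ℕ} (hx : IsScaledMonomial q x γ) (hy : IsScaledMonomial q y δ) :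
    IsScaledMonomial q (x * y) (γ + δ) := by
  have key : ∀ l : List (Fin n), IsScaledMonomial q ((l.map fun i => QX F n q i ^ γ i).prod * y)
      ((l.map fun i => (Pi.single i (γ i) : Fin n → ℕ)).sum + δ) := by
    intro l
    induction l with
    | nil => simpa using hy
    | cons a l ih =>
      simp only [List.map_cons, List.prod_cons, List.sum_cons, mul_assoc, add_assoc]
      exact ih.QX_pow_mul hq a _
  obtain ⟨c, hc, rfl⟩ := hx
  obtain ⟨d, hd, h⟩ := key (List.finRange n)
  refine ⟨c * d, mul_ne_zero hc hd, ?_⟩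
  rw [← Fin.sum_univ_def, Finset.univ_sum_single] at h
  rw [smul_mul_assoc, QMonomial, h, smul_smul]

theorem IsScaledMonomial.pow (hq : MultAntisym F q) {x : QuantumAffineSpace F n q}
    {γ : Fin n → ℕ} (hx : IsScaledMonomial q x γ) (k : ℕ) :
    IsScaledMonomial q (x ^ k) (k • γ) := by
  induction k with
  | zero => simpa using IsScaledMonomial.one
  | succ k ih => rw [pow_succ, succ_nsmul]; exact ih.mul hq hx

theorem IsScaledMonomial.exponent_unique (hq : MultAntisym F q) {x : QuantumAffineSpace F n q}
    {γ δ : Fin n → ℕ} (hx : IsScaledMonomial q x γ) (hy : IsScaledMonomial q x δ) : γ = δ := by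
  obtain ⟨c, hc, rfl⟩ := hx
  obtain ⟨d, hd, h⟩ := hy
  have := congrArg (QBasis hq).repr h
  simp only [← QBasis_apply hq, map_smul, (QBasis hq).repr_self, Finsupp.smul_single,
    smul_eq_mul, mul_one] at this
  exact ((Finsupp.single_eq_single_iff _ _ _ _).1 this).elim (·.1) (fun h => absurd h.1 hc)

theorem IsScaledMonomial.map_QMonomial (hq : MultAntisym F q)
    (σ : QuantumAffineSpace F n q ≃ₐ[F] QuantumAffineSpace F n q) {g : Fin n → Fin n → ℕ}
    (hg : ∀ i, IsScaledMonomial q (σ (QX F n q i)) (g i)) (δ : Fin n → ℕ) :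
    IsScaledMonomial q (σ (QMonomial q δ)) (∑ i, δ i • g i) := by
  have key : ∀ l : List (Fin n), IsScaledMonomial q (σ (l.map fun i => QX F n q i ^ δ i).prod)
      ((l.map fun i => δ i • g i).sum) := by
    intro l
    induction l with
    | nil => simpa using IsScaledMonomial.one
    | cons a l ih =>
      simp only [List.map_cons, List.prod_cons, List.sum_cons, map_mul, map_pow σ]
      exact ((hg a).pow hq _).mul hq ih
  rw [Fin.sum_univ_def]
  exact key _

theorem exists_QMonomial_mul_QMonomial (hq : MultAntisym F q) (γ δ : Fin n → ℕ) :
    ∃ c : F, c ≠ 0 ∧ QMonomial q γ * QMonomial q δ = c • QMonomial q (γ + δ) :=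
  IsScaledMonomial.mul hq ⟨1, one_ne_zero, (one_smul _ _).symm⟩
    ⟨1, one_ne_zero, (one_smul _ _).symm⟩

/-- The generators are normal elements. -/
theorem exists_QX_mul_eq_mul_QX (hq : MultAntisym F q) (i : Fin n)
    (z : QuantumAffineSpace F n q) : ∃ z', QX F n q i * z = z' * QX F n q i := by
  have hz : z ∈ Submodule.span F (Set.range (QMonomial q)) := by
    rw [span_range_QMonomial hq]; trivial
  induction hz using Submodule.span_induction with
  | mem x hx =>
    obtain ⟨γ, rfl⟩ := hx
    refine ⟨(∏ k, q k i ^ γ k)⁻¹ • QMonomial q γ, ?_⟩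
    rw [smul_mul_assoc, QMonomial_mul_QX hq, inv_smul_smul₀]
    exact Finset.prod_ne_zero_iff.2 fun k _ => pow_ne_zero _ (hq.1 _ _)
  | zero => exact ⟨0, by simp⟩
  | add x y _ _ hx hy =>
    obtain ⟨x', hx⟩ := hx
    obtain ⟨y', hy⟩ := hy
    exact ⟨x' + y', by rw [mul_add, add_mul, hx, hy]⟩
  | smul c x _ hx =>
    obtain ⟨x', hx⟩ := hx
    exact ⟨c • x', by rw [mul_smul_comm, smul_mul_assoc, hx]⟩

/-- If `y * u = u * X j` with `u ≠ 0`, then `y` is a multiple of `X j`. -/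
theorem exists_eq_smul_QX_of_mul_eq (hq : MultAntisym F q) {y u : QuantumAffineSpace F n q}
    {j : Fin n} (hu : u ≠ 0) (h : y * u = u * QX F n q j) : ∃ c : F, y = c • QX F n q j := by
  choose c hc hmul using exists_QMonomial_mul_QMonomial hq
  let b := (QBasis hq).reindex (toLex (α := Fin n → ℕ))
  have hb : ∀ γ, b γ = QMonomial q (ofLex γ) := fun γ => by
    rw [Module.Basis.reindex_apply, QBasis_apply]; rfl
  have key := eq_of_mem_support_of_mul_eq_mul_basis b (fun γ δ => c (ofLex γ) (ofLex δ))
    (fun _ _ => hc _ _) (fun γ δ => by simp only [hb, hmul, ofLex_add]) y u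
    (toLex (Pi.single j 1)) hu (by rw [hb, ofLex_toLex, QMonomial_single, h])
  refine ⟨b.repr y (toLex (Pi.single j 1)), ?_⟩
  conv_lhs => rw [← b.linearCombination_repr y]
  rw [Finsupp.linearCombination_apply, Finsupp.sum_of_support_subset
    (s := {toLex (Pi.single j 1)}) _ (fun γ hγ => Finset.mem_singleton.2 (key γ hγ)) _ (by simp),
    Finset.sum_singleton, hb, ofLex_toLex, QMonomial_single]

/-- Commutation with `X j` up to a scalar `c` forces every monomial to commute up to `c`. -/
theorem prod_pow_eq_of_repr_ne_zero (hq : MultAntisym F q) {u : QuantumAffineSpace F n q}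
    {j : Fin n} {c : F} (h : c • QX F n q j * u = u * QX F n q j) {γ : Fin n → ℕ}
    (hγ : (QBasis hq).repr u γ ≠ 0) : ∏ k, q k j ^ γ k = c := by
  choose d hd hmul using QX_mul_QMonomial hq j
  set b := QBasis hq
  have hL : c • QX F n q j * u = ∑ δ ∈ (b.repr u).support,
      (c * b.repr u δ * d δ) • QMonomial q (Pi.single j 1 + δ) := by
    conv_lhs => rw [← b.linearCombination_repr u]
    simp only [Finsupp.linearCombination_apply, Finsupp.sum, Finset.mul_sum, smul_mul_assoc,
      mul_smul_comm, b, QBasis_apply, hmul, smul_smul]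
    exact Finset.sum_congr rfl fun δ _ => by ring_nf
  have hR : u * QX F n q j = ∑ δ ∈ (b.repr u).support,
      ((∏ k, q k j ^ δ k) * b.repr u δ * d δ) • QMonomial q (Pi.single j 1 + δ) := by
    conv_lhs => rw [← b.linearCombination_repr u]
    simp only [Finsupp.linearCombination_apply, Finsupp.sum, Finset.sum_mul, smul_mul_assoc,
      b, QBasis_apply, QMonomial_mul_QX hq, hmul, smul_smul]
    exact Finset.sum_congr rfl fun δ _ => by ring_nf
  have hli : LinearIndependent F fun δ : Fin n → ℕ => QMonomial q (Pi.single j 1 + δ) :=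
    (linearIndependent_QMonomial hq).comp _ (add_right_injective _)
  rw [hL, hR] at h
  have h0 := linearIndependent_iff'ₛ.1 hli _ _ _ h γ (Finsupp.mem_support_iff.2 hγ)
  exact (mul_right_cancel₀ hγ (mul_right_cancel₀ (hd γ) h0)).symm

theorem QX_ne_zero (hq : MultAntisym F q) (i : Fin n) : QX F n q i ≠ 0 := by
  rw [← QMonomial_single]
  exact (linearIndependent_QMonomial hq).ne_zero _

/-- In dimension one, automorphisms send generators to scalar multiples of monomials. -/
theorem exists_isScaledMonomial_map_QX (hn : 2 ≤ n) (hq : MultAntisym F q)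
    (hdim : ∀ γ γ' : Fin n → ℤ, bicharOfMatrix q γ γ' = 1 → ¬ LinearIndependent ℤ ![γ, γ'])
    (σ : QuantumAffineSpace F n q ≃ₐ[F] QuantumAffineSpace F n q) (i : Fin n) :
    ∃ γ, IsScaledMonomial q (σ (QX F n q i)) γ := by
  set u := σ (QX F n q i) with hu
  have hu0 : u ≠ 0 := by simpa [hu] using QX_ne_zero hq i
  have hcomm : ∀ j, ∃ c : F, c • QX F n q j * u = u * QX F n q j := by
    intro j
    obtain ⟨z, hz⟩ := exists_QX_mul_eq_mul_QX hq i (σ.symm (QX F n q j))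
    have hz' : σ z * u = u * QX F n q j := by
      have := congrArg σ hz
      rw [map_mul, map_mul, σ.apply_symm_apply] at this
      exact this.symm
    obtain ⟨c, hc⟩ := exists_eq_smul_QX_of_mul_eq hq hu0 hz'
    exact ⟨c, by rw [← hc, hz']⟩
  choose c hc using hcomm
  have hsupp : ((QBasis hq).repr u).support.Nonempty := by
    rw [Finsupp.support_nonempty_iff]
    simpa using hu0
  obtain ⟨γ, hγ⟩ := hsupp
  have hγ' := Finsupp.mem_support_iff.1 hγ
  refine ⟨γ, (QBasis hq).repr u γ, hγ', ?_⟩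
  conv_lhs => rw [← (QBasis hq).linearCombination_repr u]
  rw [Finsupp.linearCombination_apply, Finsupp.sum_of_support_subset (s := {γ}) _ _ _ (by simp),
    Finset.sum_singleton, QBasis_apply]
  intro δ hδ
  rw [Finset.mem_singleton]
  refine eq_of_prod_pow_eq hn hq hdim fun j => ?_
  rw [prod_pow_eq_of_repr_ne_zero hq (hc j) hγ',
    prod_pow_eq_of_repr_ne_zero hq (hc j) (Finsupp.mem_support_iff.1 hδ)]

end QuantumAffineSpace

theorem exists_eq_single_of_sum_smul_eq_single {n : ℕ} {δ : Fin n → ℕ} {g : Fin n → Fin n → ℕ}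
    {j : Fin n} (h : ∑ i, δ i • g i = Pi.single j 1) : ∃ i, g i = Pi.single j 1 := by
  have hj : ∑ i, δ i * g i j ≠ 0 := by
    have := congrFun h j
    simp at this
    simp [this]
  obtain ⟨i, -, hi⟩ := Finset.exists_ne_zero_of_sum_ne_zero hj
  rw [mul_ne_zero_iff] at hi
  refine ⟨i, ?_⟩
  have hle : ∀ k, g i k ≤ (Pi.single j 1 : Fin n → ℕ) k := by
    intro k
    rw [← h, Finset.sum_apply]
    refine le_trans ?_ (Finset.single_le_sum (f := fun i => (δ i • g i) k)
      (fun _ _ => Nat.zero_le _) (Finset.mem_univ i))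
    exact Nat.le_mul_of_pos_left _ (Nat.pos_of_ne_zero hi.1)
  funext k
  refine le_antisymm (hle k) ?_
  by_cases hk : k = j
  · subst hk
    rw [Pi.single_eq_same]
    exact Nat.one_le_iff_ne_zero.2 hi.2
  · simp [hk]

theorem triviality_of_aut_of_dimension_one (F : Type*) [Field F]
    (n : ℕ) (hn : 2 ≤ n) (q : Fin n → Fin n → F) (hq : MultAntisym F q)
    (hdim : ∀ γ γ' : Fin n → ℤ, bicharOfMatrix q γ γ' = 1 →
      ¬ LinearIndependent ℤ ![γ, γ']) :
    ∀ σ : QuantumAffineSpace F n q ≃ₐ[F] QuantumAffineSpace F n q, IsScalarAut F n q σ := by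
  intro σ
  choose g hg using exists_isScaledMonomial_map_QX hn hq hdim σ
  have hsurj : ∀ j, ∃ i, g i = Pi.single j 1 := by
    intro j
    obtain ⟨δ, c, hc, h⟩ := exists_isScaledMonomial_map_QX hn hq hdim σ.symm j
    obtain ⟨d, hd, h'⟩ := IsScaledMonomial.map_QMonomial hq σ hg δ
    have hj : IsScaledMonomial q (QX F n q j) (∑ i, δ i • g i) := by
      refine ⟨c * d, mul_ne_zero hc hd, ?_⟩
      rw [← σ.apply_symm_apply (QX F n q j), h, map_smul, h', smul_smul]
    exact exists_eq_single_of_sum_smul_eq_single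
      (hj.exponent_unique hq ⟨1, one_ne_zero, by rw [one_smul, QMonomial_single]⟩)
  choose f hf using hsurj
  have hinj : Function.Injective f := by
    intro i j hij
    have := (hf i).symm.trans ((congrArg g hij).trans (hf j))
    by_contra hne
    have := congrFun this i
    simp [hne] at this
  have hscaled : ∀ j, ∃ c : F, c ≠ 0 ∧ σ (QX F n q (f j)) = c • QX F n q j := by
    intro j
    obtain ⟨c, hc, h⟩ := hg (f j)
    exact ⟨c, hc, by rw [h, hf, QMonomial_single]⟩
  choose a ha hσ using hscaled
  have hpres : ∀ i j, q (f i) (f j) = q i j := by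
    intro i j
    have h := congrArg σ (QX_mul_QX hq (f i) (f j))
    rw [map_smul, map_mul, map_mul, hσ, hσ, smul_mul_smul_comm, smul_mul_smul_comm,
      QX_mul_QX hq i j, smul_smul, smul_smul] at h
    obtain ⟨c, hc, hm⟩ := QX_mul_QMonomial hq j (Pi.single i 1)
    rw [QMonomial_single] at hm
    have hne : QX F n q j * QX F n q i ≠ 0 := by
      rw [hm]
      exact smul_ne_zero hc ((linearIndependent_QMonomial hq).ne_zero _)
    have h' := smul_left_injective F hne h
    have haa : a j * a i ≠ 0 := mul_ne_zero (ha j) (ha i)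
    refine mul_right_cancel₀ haa (h'.symm.trans ?_)
    ring
  have hid := apply_eq_self_of_forall_apply_eq hq hdim (Finite.injective_iff_bijective.1 hinj) hpres
  exact ⟨a, ha, fun i => by rw [← hσ i, hid i]⟩
end
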